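/- arXiv:2602.23631 — 2 statements merged into one kernel-verified Lean document; each statement's English description precedes it below -/
import Mathlib

section
/- Lemma (Lemma 5.4). Let Q ⊆ V be a full-dimensional simple polytope. For an extreme point v of Q, let T_v denote the set of facets of Q containing v (by simplicity, |T_v| = n). Then for any two extreme points v and w of Q there exists a real number c > 0 such that, in the polytopal algebra 𝒜(Q), the class of the square-free monomial ∏_{F ∈ T_v} X_F equals c times the class of ∏_{F ∈ T_w} X_F. -/
open scoped RealInnerProductSpace

noncomputable section

variable {V : Type*} [NormedAddCommGroup V] [InnerProductSpace ℝ V]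

/-- The reflection `r_α` across the hyperplane orthogonal to `α`:
`r_α(x) = x − (2⟪x,α⟫/⟪α,α⟫) α`. -/
def reflMap (α : V) : V → V := fun x => x - (2 * ⟪x, α⟫ / ⟪α, α⟫) • α

/-- The hyperplane `H_α = {x | ⟪x, α⟫ = 0}` fixed by `reflMap α`. -/
def hplane (α : V) : Set V := {x : V | ⟪x, α⟫ = 0}

/-- `F` is a facet of the full-dimensional polytope `Q`: an exposed face whose affine
span has dimension `n − 1` (where `n = dim V`). -/
def IsFacet (Q F : Set V) : Prop :=
  IsExposed ℝ Q F ∧ Module.finrank ℝ (affineSpan ℝ F).direction + 1 = Module.finrank ℝ V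

open Classical in
/-- The barycenter of a nonempty face: the centroid of its finitely many extreme points. -/
def barycenter (F : Set V) : V :=
  if h : (Set.extremePoints ℝ F).Finite then h.toFinset.centroid ℝ id else 0

/-- A full-dimensional polytope is simple if every extreme point lies in exactly `n` facets. -/
def IsSimple (Q : Set V) : Prop :=
  ∀ v ∈ Set.extremePoints ℝ Q, {F : Set V | IsFacet Q F ∧ v ∈ F}.ncard = Module.finrank ℝ V

/-- The type of facets of `Q`. -/
abbrev Facets (Q : Set V) := {F : Set V // IsFacet Q F}

/-- `u` is the unit outward normal of the facet `F` of `Q`. -/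
def IsOutwardNormal (Q F : Set V) (u : V) : Prop :=
  ‖u‖ = 1 ∧ F = {x ∈ Q | ∀ y ∈ Q, ⟪u, y⟫ ≤ ⟪u, x⟫}

open Classical in
/-- The unit outward normal `ℓ_F` of a facet `F` of `Q`. -/
def normalVec (Q F : Set V) : V :=
  if h : ∃ u : V, IsOutwardNormal Q F u then h.choose else 0

/-- The Stanley–Reisner ideal `I_Q`, generated by the square-free monomials
`X_{F_1} ⋯ X_{F_p}` with `F_1 ∩ ⋯ ∩ F_p = ∅`. -/
def srIdeal (Q : Set V) : Ideal (MvPolynomial (Facets Q) ℝ) :=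
  Ideal.span {p | ∃ t : Finset (Facets Q), (⋂ F ∈ t, (F.1 : Set V)) = ∅ ∧
    p = ∏ F ∈ t, MvPolynomial.X F}

/-- The ideal `J_Q` generated by the linear forms `∑_F ⟪u, ℓ_F⟫ X_F` for `u ∈ V`. -/
def linIdeal (Q : Set V) : Ideal (MvPolynomial (Facets Q) ℝ) :=
  Ideal.span {p | ∃ u : V,
    p = ∑ᶠ F : Facets Q, MvPolynomial.C ⟪u, normalVec Q F.1⟫ * MvPolynomial.X F}

/-- The ideal `I_Q + J_Q`. -/
def polyIdeal (Q : Set V) : Ideal (MvPolynomial (Facets Q) ℝ) := srIdeal Q + linIdeal Q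

/-- The polytopal algebra `𝒜(Q) = ℝ[X_F : F ∈ 𝔉(Q)]/(I_Q + J_Q)`. -/
abbrev PolyAlg (Q : Set V) := MvPolynomial (Facets Q) ℝ ⧸ polyIdeal Q

/-- The quotient map onto the polytopal algebra. -/
def polyMk (Q : Set V) : MvPolynomial (Facets Q) ℝ →ₐ[ℝ] PolyAlg Q :=
  Ideal.Quotient.mkₐ ℝ (polyIdeal Q)

/-- The invariant subalgebra of an action `ρ` of a monoid `G` by `ℝ`-algebra
automorphisms: the elements fixed by every `ρ g`. -/
def invariants {A : Type*} [CommRing A] [Algebra ℝ A] {G : Type*} [Monoid G]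
    (ρ : G →* (A ≃ₐ[ℝ] A)) : Subalgebra ℝ A where
  carrier := {a : A | ∀ g : G, ρ g a = a}
  mul_mem' := fun {a b} ha hb g => by
    simp only [Set.mem_setOf_eq] at ha hb ⊢
    rw [map_mul, ha g, hb g]
  one_mem' := fun g => map_one (ρ g)
  add_mem' := fun {a b} ha hb g => by
    simp only [Set.mem_setOf_eq] at ha hb ⊢
    rw [map_add, ha g, hb g]
  zero_mem' := fun g => map_zero (ρ g)
  algebraMap_mem' := fun r g => (ρ g).commutes r

open Classical in
/-- The square-free monomial `∏_{F ∈ T_v} X_F` over the facets of `Q` containing `v`. -/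
noncomputable def vertMonomial (Q : Set V) (v : V) : MvPolynomial (Facets Q) ℝ :=
  ∏ᶠ F : Facets Q, if v ∈ F.1 then MvPolynomial.X F else 1

/-! ### Polytopes and their facets -/

theorem eq_zero_of_forall_inner_eq {Q : Set V} (hfull : (interior Q).Nonempty) {m : V} {c : ℝ}
    (h : ∀ x ∈ Q, ⟪m, x⟫ = c) : m = 0 := by
  obtain ⟨p, hp⟩ := hfull
  have hcont : Filter.Tendsto (fun t : ℝ => p + t • m) (nhdsWithin 0 (Set.Ioi 0)) (nhds p) := by
    have : Continuous fun t : ℝ => p + t • m := by fun_prop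
    simpa using (this.tendsto 0).mono_left nhdsWithin_le_nhds
  obtain ⟨t, ht, ht0⟩ := ((hcont.eventually (mem_interior_iff_mem_nhds.1 hp)).and
    self_mem_nhdsWithin).exists
  have h1 := h _ ht
  have h2 := h p (interior_subset hp)
  rw [inner_add_right, inner_smul_right, h2] at h1
  have h3 : t * ⟪m, m⟫ = 0 := by linarith
  rcases mul_eq_zero.1 h3 with h4 | h4
  · exact absurd h4 (ne_of_gt ht0)
  · exact inner_self_eq_zero.1 h4

theorem inner_le_of_convexHull {A : Set V} {l : V} {c : ℝ} (h : ∀ a ∈ A, ⟪l, a⟫ ≤ c) :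
    ∀ x ∈ convexHull ℝ A, ⟪l, x⟫ ≤ c := by
  intro x hx
  have hconv : Convex ℝ {x : V | ⟪l, x⟫ ≤ c} :=
    convex_halfSpace_le (innerSL ℝ l).toLinearMap.isLinear c
  exact convexHull_min h hconv hx

theorem IsFacet.exists_isOutwardNormal [FiniteDimensional ℝ V] {Q F : Set V}
    (hfull : (interior Q).Nonempty) (hF : IsFacet Q F) (hne : F.Nonempty) :
    ∃ u, IsOutwardNormal Q F u := by
  obtain ⟨l, hl⟩ := hF.1 hne
  obtain ⟨g, rfl⟩ := (InnerProductSpace.toDual ℝ V).surjective l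
  simp only [InnerProductSpace.toDual_apply_apply] at hl
  have hg : g ≠ 0 := by
    rintro rfl
    have hFQ : F = Q := by simpa using hl
    have htop : affineSpan ℝ F = ⊤ := by
      rw [hFQ, eq_top_iff, ← isOpen_interior.affineSpan_eq_top hfull]
      exact affineSpan_mono ℝ interior_subset
    have h2 := hF.2
    rw [htop, AffineSubspace.direction_top, finrank_top] at h2
    omega
  have hpos : 0 < ‖g‖⁻¹ := inv_pos.2 (norm_pos_iff.2 hg)
  refine ⟨‖g‖⁻¹ • g, ?_, ?_⟩
  · rw [norm_smul, norm_inv, norm_norm, inv_mul_cancel₀ (norm_ne_zero_iff.2 hg)]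
  · rw [hl]
    ext x
    simp only [Set.mem_ofPred_eq, real_inner_smul_left]
    simp only [mul_le_mul_iff_right₀ hpos]

theorem IsFacet.isOutwardNormal_normalVec [FiniteDimensional ℝ V] {Q F : Set V}
    (hfull : (interior Q).Nonempty) (hF : IsFacet Q F) (hne : F.Nonempty) :
    IsOutwardNormal Q F (normalVec Q F) := by
  have h := hF.exists_isOutwardNormal hfull hne
  rw [normalVec, dif_pos h]
  exact h.choose_spec

theorem IsFacet.subset {Q F : Set V} (hF : IsFacet Q F) : F ⊆ Q := hF.1.subset

theorem IsFacet.inner_normalVec_le [FiniteDimensional ℝ V] {Q F : Set V}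
    (hfull : (interior Q).Nonempty) (hF : IsFacet Q F) {v x : V} (hv : v ∈ F) (hx : x ∈ Q) :
    ⟪normalVec Q F, x⟫ ≤ ⟪normalVec Q F, v⟫ := by
  have h := (hF.isOutwardNormal_normalVec hfull ⟨v, hv⟩).2
  have hv' := hv
  rw [h] at hv'
  exact hv'.2 x hx

theorem IsFacet.mem_iff [FiniteDimensional ℝ V] {Q F : Set V}
    (hfull : (interior Q).Nonempty) (hF : IsFacet Q F) {v x : V} (hv : v ∈ F) (hx : x ∈ Q) :
    x ∈ F ↔ ⟪normalVec Q F, x⟫ = ⟪normalVec Q F, v⟫ := by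
  constructor
  · intro hxF
    exact le_antisymm (hF.inner_normalVec_le hfull hv hx)
      (hF.inner_normalVec_le hfull hxF (hF.subset hv))
  · intro h
    rw [(hF.isOutwardNormal_normalVec hfull ⟨v, hv⟩).2]
    exact ⟨hx, fun y hy => h ▸ hF.inner_normalVec_le hfull hv hy⟩

theorem finite_extremePoints {Q : Set V} (hQ : ∃ A : Set V, A.Finite ∧ Q = convexHull ℝ A) :
    (Set.extremePoints ℝ Q).Finite := by
  obtain ⟨A, hA, rfl⟩ := hQ
  exact hA.subset extremePoints_convexHull_subset

/-- A polytope has only finitely many facets. -/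
theorem finite_facets {Q : Set V} (hQ : ∃ A : Set V, A.Finite ∧ Q = convexHull ℝ A) :
    Finite (Facets Q) := by
  have hext := finite_extremePoints hQ
  obtain ⟨A, hA, rfl⟩ := hQ
  have hcomp : IsCompact (convexHull ℝ A) := hA.isCompact_convexHull ℝ
  have hconv : Convex ℝ (convexHull ℝ A) := convex_convexHull ℝ A
  have hfin : Finite (Set.powerset (Set.extremePoints ℝ (convexHull ℝ A))) :=
    hext.finite_subsets.to_subtype
  refine Finite.of_injective
    (β := Set.powerset (Set.extremePoints ℝ (convexHull ℝ A)))
    (fun F => ⟨F.1.extremePoints ℝ,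
      (F.2.1.isExtreme).extremePoints_subset_extremePoints⟩) ?_
  intro F G hFG
  have h : F.1.extremePoints ℝ = G.1.extremePoints ℝ := congrArg Subtype.val hFG
  apply Subtype.ext
  rw [← closure_convexHull_extremePoints (F.2.1.isCompact hcomp) (F.2.1.convex hconv), h,
    closure_convexHull_extremePoints (G.2.1.isCompact hcomp) (G.2.1.convex hconv)]

/-! ### The tangent cone at a vertex -/

/-- A direction not pointing into the polytope from a vertex is separated from it. -/
theorem exists_separating_of_not_mem {A : Set V} (hA : A.Finite) {v u : V}
    [FiniteDimensional ℝ V]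
    (hv : v ∈ Set.extremePoints ℝ (convexHull ℝ A))
    (hu : ∀ t : ℝ, 0 < t → v + t • u ∉ convexHull ℝ A) :
    ∃ l : V, (∀ a ∈ A, ⟪l, a - v⟫ ≤ 0) ∧ 0 < ⟪l, u⟫ := by
  have hu0 : u ≠ 0 := by
    rintro rfl
    exact hu 1 one_pos (by simpa using hv.1)
  have hsub : convexHull ℝ (A \ {v}) ⊆ convexHull ℝ A := convexHull_mono Set.sdiff_subset
  have hvK : v ∉ convexHull ℝ (A \ {v}) := fun h =>
    (extremePoints_convexHull_subset
      (inter_extremePoints_subset_extremePoints_of_subset hsub ⟨h, hv⟩)).2 rfl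
  have hray : IsClosed ((fun t : ℝ => v + t • u) '' Set.Ici 0) := by
    have : Topology.IsClosedEmbedding (fun t : ℝ => v + t • u) :=
      (Homeomorph.addLeft v).isClosedEmbedding.comp (isClosedEmbedding_smul_left hu0)
    exact this.isClosedMap _ isClosed_Ici
  have hrayc : Convex ℝ ((fun t : ℝ => v + t • u) '' Set.Ici 0) := by
    rintro _ ⟨s, hs, rfl⟩ _ ⟨t, ht, rfl⟩ a b ha hb hab
    refine ⟨a * s + b * t, ?_, ?_⟩
    · simp only [Set.mem_Ici] at hs ht ⊢
      positivity
    · obtain rfl : b = 1 - a := by linarith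
      simp only
      module
  have hdisj : Disjoint (convexHull ℝ (A \ {v})) ((fun t : ℝ => v + t • u) '' Set.Ici 0) := by
    rw [Set.disjoint_left]
    rintro _ hx ⟨t, ht, rfl⟩
    rcases (Set.mem_Ici.1 ht).eq_or_lt with rfl | ht
    · simp only [zero_smul, add_zero] at hx
      exact hvK hx
    · exact hu t ht (hsub hx)
  obtain ⟨f, r, s, hr, hrs, hs⟩ := geometric_hahn_banach_compact_closed (convex_convexHull ℝ _)
    (hA.sdiff.isCompact_convexHull ℝ) hrayc hray hdisj
  obtain ⟨g, rfl⟩ := (InnerProductSpace.toDual ℝ V).surjective f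
  simp only [InnerProductSpace.toDual_apply_apply] at hr hs
  have hgv : s < ⟪g, v⟫ := by simpa using hs _ ⟨0, Set.mem_Ici.2 le_rfl, rfl⟩
  have hgu : 0 ≤ ⟪g, u⟫ := by
    by_contra! hneg
    have h := hs _ ⟨(⟪g, v⟫ - s) / (-⟪g, u⟫), Set.mem_Ici.2 (by
      apply div_nonneg <;> linarith), rfl⟩
    rw [inner_add_right, inner_smul_right] at h
    have : (⟪g, v⟫ - s) / (-⟪g, u⟫) * ⟪g, u⟫ = -(⟪g, v⟫ - s) := by
      have := hneg.ne
      field_simp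
    linarith
  have hev : ∀ᶠ ε : ℝ in nhdsWithin 0 (Set.Ioi 0), ∀ a ∈ A \ {v}, ⟪g + ε • u, a - v⟫ < 0 := by
    rw [Filter.eventually_all_finite hA.sdiff]
    intro a ha
    have hc : Continuous fun ε : ℝ => ⟪g + ε • u, a - v⟫ := by fun_prop
    have h0 : ⟪g + (0 : ℝ) • u, a - v⟫ < 0 := by
      have := hr a (subset_convexHull ℝ _ ha)
      rw [zero_smul, add_zero, inner_sub_right]
      linarith
    exact ((hc.tendsto 0).eventually (gt_mem_nhds h0)).filter_mono nhdsWithin_le_nhds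
  obtain ⟨ε, hε, hε0⟩ := (hev.and self_mem_nhdsWithin).exists
  refine ⟨g + ε • u, fun a ha => ?_, ?_⟩
  · by_cases hav : a = v
    · simp [hav]
    · exact (hε a ⟨ha, hav⟩).le
  · rw [inner_add_left, real_inner_smul_left]
    have : 0 < ⟪u, u⟫ := real_inner_self_pos.2 hu0
    have := mul_pos (Set.mem_Ioi.1 hε0) this
    linarith

/-- Among the functionals that are nonpositive on finitely many vectors spanning the space and
positive at `u`, there is one whose zero set among these vectors has codimension at most one. -/
theorem exists_separating_tight {ι : Type*} (A : Finset ι) (g : ι → V)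
    (hspan : ∀ m : V, (∀ a ∈ A, ⟪m, g a⟫ = 0) → m = 0) {u : V}
    (hex : ∃ l : V, (∀ a ∈ A, ⟪l, g a⟫ ≤ 0) ∧ 0 < ⟪l, u⟫) :
    ∃ l : V, ((∀ a ∈ A, ⟪l, g a⟫ ≤ 0) ∧ 0 < ⟪l, u⟫) ∧
      ∀ m : V, (∀ a ∈ A, ⟪l, g a⟫ = 0 → ⟪m, g a⟫ = 0) → ⟪m, u⟫ = 0 → m = 0 := by
  classical
  let tight : V → Finset ι := fun l => A.filter fun a => ⟪l, g a⟫ = 0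
  let P : V → Prop := fun l => (∀ a ∈ A, ⟪l, g a⟫ ≤ 0) ∧ 0 < ⟪l, u⟫
  have hfin : {T : Finset ι | ∃ l, P l ∧ tight l = T}.Finite :=
    A.powerset.finite_toSet.subset (by
      rintro _ ⟨l, -, rfl⟩
      exact Finset.mem_coe.2 (Finset.mem_powerset.2 (Finset.filter_subset _ _)))
  obtain ⟨l₀, hl₀⟩ := hex
  obtain ⟨_, ⟨l, hl, rfl⟩, hmax⟩ := Set.exists_max_image _ Finset.card hfin ⟨_, l₀, hl₀, rfl⟩
  refine ⟨l, hl, fun m hm hmu => ?_⟩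
  have key : ∀ m : V, (∀ a ∈ A, ⟪l, g a⟫ = 0 → ⟪m, g a⟫ = 0) → ⟪m, u⟫ = 0 →
      ∀ a ∈ A, ⟪m, g a⟫ ≤ 0 := by
    intro m hm hmu
    by_contra! hcon
    obtain ⟨a₀, ha₀, hma₀⟩ := hcon
    obtain ⟨b, hb, hbmin⟩ := Finset.exists_min_image (A.filter fun a => 0 < ⟪m, g a⟫)
      (fun a => -⟪l, g a⟫ / ⟪m, g a⟫) ⟨a₀, by simp [ha₀, hma₀]⟩
    rw [Finset.mem_filter] at hb
    obtain ⟨hbA, hmb⟩ := hb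
    set s := -⟪l, g b⟫ / ⟪m, g b⟫ with hs
    have hs0 : 0 ≤ s := div_nonneg (by linarith [hl.1 b hbA]) hmb.le
    have hval : ∀ x, ⟪l + s • m, x⟫ = ⟪l, x⟫ + s * ⟪m, x⟫ := fun x => by
      rw [inner_add_left, real_inner_smul_left]
    have hP : P (l + s • m) := by
      refine ⟨fun a ha => ?_, ?_⟩
      · rw [hval]
        by_cases hpos : 0 < ⟪m, g a⟫
        · have := hbmin a (by simp [ha, hpos])
          rw [le_div_iff₀ hpos] at this
          linarith
        · have := hl.1 a ha
          nlinarith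
      · rw [hval, hmu]
        linarith [hl.2]
    have hsub : tight l ⊂ tight (l + s • m) := by
      rw [Finset.ssubset_iff_of_subset]
      · refine ⟨b, ?_, ?_⟩
        · simp only [tight, Finset.mem_filter, hval]
          refine ⟨hbA, ?_⟩
          rw [hs, div_mul_cancel₀ _ hmb.ne']
          ring
        · simp only [tight, Finset.mem_filter, not_and]
          intro _ h
          exact hmb.ne' (hm b hbA h)
      · intro a ha
        simp only [tight, Finset.mem_filter, hval] at ha ⊢
        refine ⟨ha.1, ?_⟩
        rw [ha.2, hm a ha.1 ha.2]
        ring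
    exact absurd (Finset.card_lt_card hsub) (not_lt.2 (hmax _ ⟨_, hP, rfl⟩))
  refine hspan m fun a ha => le_antisymm (key m hm hmu a ha) ?_
  have := key (-m) (fun a ha h => by rw [inner_neg_left, hm a ha h, neg_zero])
    (by rw [inner_neg_left, hmu, neg_zero]) a ha
  rw [inner_neg_left] at this
  linarith

/-- A direction not pointing into the polytope from a vertex violates the inequality of a facet
through this vertex. -/
theorem exists_facet_inner_pos [FiniteDimensional ℝ V] {Q : Set V}
    (hQ : ∃ A : Set V, A.Finite ∧ Q = convexHull ℝ A) (hfull : (interior Q).Nonempty)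
    {v u : V} (hv : v ∈ Set.extremePoints ℝ Q) (hu : ∀ t : ℝ, 0 < t → v + t • u ∉ Q) :
    ∃ F : Set V, IsFacet Q F ∧ v ∈ F ∧ 0 < ⟪normalVec Q F, u⟫ := by
  obtain ⟨A, hA, rfl⟩ := hQ
  lift A to Finset V using hA
  obtain ⟨l, ⟨hl, hlu⟩, htight⟩ := exists_separating_tight A (fun a => a - v)
    (fun m hm => by
      refine eq_zero_of_forall_inner_eq (c := ⟪m, v⟫) hfull fun x hx => le_antisymm ?_ ?_
      · refine inner_le_of_convexHull (fun a ha => ?_) x hx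
        have := hm a ha
        rw [inner_sub_right] at this
        linarith
      · have := inner_le_of_convexHull (l := -m) (c := ⟪-m, v⟫) (fun a ha => ?_) x hx
        · rw [inner_neg_left, inner_neg_left] at this
          linarith
        · have := hm a ha
          rw [inner_sub_right] at this
          rw [inner_neg_left, inner_neg_left]
          linarith)
    (exists_separating_of_not_mem A.finite_toSet hv hu)
  set Q := convexHull ℝ (A : Set V) with hQdef
  have hl0 : l ≠ 0 := by
    rintro rfl
    simp at hlu
  have hlQ : ∀ x ∈ Q, ⟪l, x⟫ ≤ ⟪l, v⟫ := inner_le_of_convexHull fun a ha => by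
    have := hl a ha
    rw [inner_sub_right] at this
    linarith
  set F : Set V := {x ∈ Q | ∀ y ∈ Q, ⟪l, y⟫ ≤ ⟪l, x⟫} with hFdef
  have hvF : v ∈ F := ⟨hv.1, hlQ⟩
  have hFexp : IsExposed ℝ Q F := fun _ => ⟨innerSL ℝ l, by simp [hFdef]⟩
  have hmemF : ∀ x ∈ Q, ⟪l, x - v⟫ = 0 → x ∈ F := fun x hx h => by
    rw [inner_sub_right] at h
    exact ⟨hx, fun y hy => (hlQ y hy).trans (by linarith)⟩
  have hF_perp : ∀ m : V, (∀ x ∈ F, ⟪m, x⟫ = ⟪m, v⟫) → m ∈ (vectorSpan ℝ F)ᗮ := by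
    intro m hm
    rw [Submodule.mem_orthogonal']
    intro y hy
    rw [vectorSpan_eq_span_vsub_set_right ℝ hvF] at hy
    induction hy using Submodule.span_induction with
    | mem y hy =>
      obtain ⟨x, hx, rfl⟩ := hy
      simp only [vsub_eq_sub]
      rw [inner_sub_right, hm x hx, sub_self]
    | zero => exact inner_zero_right _
    | add x y _ _ hx hy => rw [inner_add_right, hx, hy, add_zero]
    | smul c x _ hx => rw [inner_smul_right, hx, mul_zero]
  have hl_perp : l ∈ (vectorSpan ℝ F)ᗮ := hF_perp l fun x hx =>
    le_antisymm (hlQ x hx.1) (hx.2 v hv.1)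
  have hperp0 : ∀ m ∈ (vectorSpan ℝ F)ᗮ, ⟪m, u⟫ = 0 → m = 0 := by
    intro m hm hmu
    refine htight m (fun a ha h => ?_) hmu
    exact (Submodule.mem_orthogonal' _ _).1 hm _ (vsub_mem_vectorSpan ℝ
      (hmemF a (subset_convexHull ℝ _ ha) h) hvF)
  have hline : ∀ m ∈ (vectorSpan ℝ F)ᗮ, m = (⟪m, u⟫ / ⟪l, u⟫) • l := by
    intro m hm
    refine sub_eq_zero.1 (hperp0 _ (Submodule.sub_mem _ hm (Submodule.smul_mem _ _ hl_perp)) ?_)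
    rw [inner_sub_left, real_inner_smul_left, div_mul_cancel₀ _ hlu.ne', sub_self]
  have hrank : Module.finrank ℝ (vectorSpan ℝ F)ᗮ = 1 := by
    have : (vectorSpan ℝ F)ᗮ = Submodule.span ℝ {l} := by
      refine le_antisymm (fun m hm => ?_) ?_
      · rw [hline m hm]
        exact Submodule.smul_mem _ _ (Submodule.mem_span_singleton_self l)
      · rwa [Submodule.span_singleton_le_iff_mem]
    rw [this, finrank_span_singleton hl0]
  have hfacet : IsFacet Q F := by
    refine ⟨hFexp, ?_⟩
    rw [direction_affineSpan, ← (vectorSpan ℝ F).finrank_add_finrank_orthogonal, hrank]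
  refine ⟨F, hfacet, hvF, ?_⟩
  have hnorm := hfacet.isOutwardNormal_normalVec hfull ⟨v, hvF⟩
  have hn0 : normalVec Q F ≠ 0 := fun h => by simpa [h] using hnorm.1
  set c := ⟪normalVec Q F, u⟫ / ⟪l, u⟫ with hc
  have hnl : normalVec Q F = c • l := hline _ (hF_perp _ fun x hx =>
    (hfacet.mem_iff hfull hvF hx.1).1 hx)
  obtain ⟨x, hxQ, hx⟩ : ∃ x ∈ Q, ⟪l, x⟫ < ⟪l, v⟫ := by
    by_contra! hcon
    exact hl0 (eq_zero_of_forall_inner_eq hfull fun x hx => le_antisymm (hlQ x hx) (hcon x hx))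
  have hle := hfacet.inner_normalVec_le hfull hvF hxQ
  have hc0 : c ≠ 0 := fun h => hn0 (by rw [hnl, h, zero_smul])
  have hcpos : 0 < c := by
    rcases hc0.lt_or_gt with h | h
    · rw [hnl, real_inner_smul_left, real_inner_smul_left] at hle
      nlinarith
    · exact h
  rw [hnl, real_inner_smul_left]
  positivity

/-- The facets through a vertex cut out the tangent cone of a polytope. -/
theorem exists_add_smul_mem [FiniteDimensional ℝ V] {Q : Set V}
    (hQ : ∃ A : Set V, A.Finite ∧ Q = convexHull ℝ A) (hfull : (interior Q).Nonempty)
    {v u : V} (hv : v ∈ Set.extremePoints ℝ Q)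
    (hu : ∀ F : Set V, IsFacet Q F → v ∈ F → ⟪normalVec Q F, u⟫ ≤ 0) :
    ∃ t : ℝ, 0 < t ∧ v + t • u ∈ Q := by
  by_contra! hcon
  obtain ⟨F, hF, hvF, hpos⟩ := exists_facet_inner_pos hQ hfull hv hcon
  exact absurd (hu F hF hvF) (not_le.2 hpos)

theorem eq_zero_of_forall_facet_inner_eq_zero [FiniteDimensional ℝ V] {Q : Set V}
    (hQ : ∃ A : Set V, A.Finite ∧ Q = convexHull ℝ A) (hfull : (interior Q).Nonempty)
    {v u : V} (hv : v ∈ Set.extremePoints ℝ Q)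
    (hu : ∀ F : Set V, IsFacet Q F → v ∈ F → ⟪normalVec Q F, u⟫ = 0) : u = 0 := by
  obtain ⟨s, hs, hsQ⟩ := exists_add_smul_mem hQ hfull hv fun F hF hvF => (hu F hF hvF).le
  obtain ⟨t, ht, htQ⟩ := exists_add_smul_mem (u := -u) hQ hfull hv fun F hF hvF => by
    rw [inner_neg_right, hu F hF hvF, neg_zero]
  have h : v ∈ openSegment ℝ (v + s • u) (v + t • (-u)) := by
    refine ⟨t / (s + t), s / (s + t), by positivity, by positivity, ?_, ?_⟩
    · field_simp
      ring
    · have hst : s + t ≠ 0 := by positivity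
      have h1 : t / (s + t) = 1 - s / (s + t) := by field_simp; ring
      have h2 : (t / (s + t)) * s = (s / (s + t)) * t := by field_simp
      have : (t / (s + t)) • (v + s • u) + (s / (s + t)) • (v + t • -u)
          = (t / (s + t) + s / (s + t)) • v
            + ((t / (s + t)) * s - (s / (s + t)) * t) • u := by module
      rw [this, h2, h1]
      simp
  have := hv.2 hsQ htQ h
  have : s • u = 0 := by simpa using this
  exact (smul_eq_zero.1 this).resolve_left hs.ne'

/-! ### Vertices of simple polytopes -/

open Classical in
/-- The finite set of facets through `v`. -/
def vertFacets (Q : Set V) [Fintype (Facets Q)] (v : V) : Finset (Facets Q) :=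
  Finset.univ.filter fun F => v ∈ F.1

theorem mem_vertFacets {Q : Set V} [Fintype (Facets Q)] {v : V} {F : Facets Q} :
    F ∈ vertFacets Q v ↔ v ∈ F.1 := by
  simp [vertFacets]

theorem vertMonomial_eq_prod {Q : Set V} [Fintype (Facets Q)] (v : V) :
    vertMonomial Q v = ∏ F ∈ vertFacets Q v, MvPolynomial.X F := by
  classical
  rw [vertMonomial, finprod_eq_prod_of_fintype, vertFacets, Finset.prod_filter]

theorem IsSimple.card_vertFacets {Q : Set V} [Fintype (Facets Q)] (hQ : IsSimple Q) {v : V}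
    (hv : v ∈ Set.extremePoints ℝ Q) : (vertFacets Q v).card = Module.finrank ℝ V := by
  classical
  rw [← hQ v hv, ← Finset.card_image_of_injective _ Subtype.val_injective, ← Set.ncard_coe_finset]
  congr 1
  ext F
  simp [mem_vertFacets, and_comm]

theorem IsSimple.eq_of_inner_eq [FiniteDimensional ℝ V] {Q : Set V} [Fintype (Facets Q)]
    (hQ : ∃ A : Set V, A.Finite ∧ Q = convexHull ℝ A) (hfull : (interior Q).Nonempty)
    {v x y : V} (hv : v ∈ Set.extremePoints ℝ Q)
    (h : ∀ F ∈ vertFacets Q v, ⟪normalVec Q F.1, x⟫ = ⟪normalVec Q F.1, y⟫) : x = y := by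
  refine sub_eq_zero.1 (eq_zero_of_forall_facet_inner_eq_zero hQ hfull hv fun F hF hvF => ?_)
  rw [inner_sub_right, h ⟨F, hF⟩ (mem_vertFacets.2 hvF), sub_self]

/-- The normals at a vertex of a simple polytope form a basis, so that a vector can be prescribed
by its inner products with them. -/
theorem IsSimple.exists_inner_eq [FiniteDimensional ℝ V] {Q : Set V} [Fintype (Facets Q)]
    (hQ : ∃ A : Set V, A.Finite ∧ Q = convexHull ℝ A) (hfull : (interior Q).Nonempty)
    (hsimple : IsSimple Q) {v : V} (hv : v ∈ Set.extremePoints ℝ Q) (f : Facets Q → ℝ) :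
    ∃ d : V, ∀ F ∈ vertFacets Q v, ⟪normalVec Q F.1, d⟫ = f F := by
  let Φ : V →ₗ[ℝ] (vertFacets Q v → ℝ) :=
    LinearMap.pi fun F => (innerSL ℝ (normalVec Q F.1.1)).toLinearMap
  have hΦ : ∀ x F, Φ x F = ⟪normalVec Q F.1.1, x⟫ := fun x F => rfl
  have hinj : Function.Injective Φ := fun x y hxy =>
    IsSimple.eq_of_inner_eq hQ hfull hv fun F hF => by
      simpa only [hΦ] using congrFun hxy ⟨F, hF⟩
  have hsurj : Function.Surjective Φ := by
    refine (LinearMap.injective_iff_surjective_of_finrank_eq_finrank ?_).1 hinj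
    rw [Module.finrank_fintype_fun_eq_card, Fintype.card_coe, hsimple.card_vertFacets hv]
  obtain ⟨d, hd⟩ := hsurj fun F => f F.1
  exact ⟨d, fun F hF => by rw [← hΦ d ⟨F, hF⟩, hd]⟩

/-- At a vertex that does not maximize a linear functional over a simple polytope, the functional
increases along some edge. -/
theorem IsSimple.exists_improving_edge [FiniteDimensional ℝ V] {Q : Set V} [Fintype (Facets Q)]
    (hQ : ∃ A : Set V, A.Finite ∧ Q = convexHull ℝ A) (hfull : (interior Q).Nonempty)
    (hsimple : IsSimple Q) {v x c : V} (hv : v ∈ Set.extremePoints ℝ Q) (hx : x ∈ Q)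
    (hc : ⟪c, v⟫ < ⟪c, x⟫) :
    ∃ F ∈ vertFacets Q v, ∃ d : V, ⟪normalVec Q F.1, d⟫ = -1 ∧
      (∀ E ∈ vertFacets Q v, E ≠ F → ⟪normalVec Q E.1, d⟫ = 0) ∧ 0 < ⟪c, d⟫ := by
  classical
  have hd := fun F : Facets Q =>
    hsimple.exists_inner_eq hQ hfull hv fun E => if E = F then (-1 : ℝ) else 0
  choose d hd using hd
  by_contra! hcon
  have hcd : ∀ F ∈ vertFacets Q v, ⟪c, d F⟫ ≤ 0 := fun F hF =>
    hcon F hF (d F) (by simp [hd F F hF]) fun E hE hEF => by simp [hd F E hE, hEF]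
  have hexp : x - v = ∑ F ∈ vertFacets Q v, (-⟪normalVec Q F.1, x - v⟫) • d F := by
    refine IsSimple.eq_of_inner_eq hQ hfull hv fun E hE => ?_
    rw [inner_sum, Finset.sum_eq_single_of_mem E hE]
    · rw [inner_smul_right, hd E E hE, if_pos rfl]
      ring
    · intro F _ hFE
      rw [inner_smul_right, hd F E hE, if_neg hFE.symm, mul_zero]
  have hle : ⟪c, x - v⟫ ≤ 0 := by
    rw [hexp, inner_sum]
    refine Finset.sum_nonpos fun F hF => ?_
    rw [inner_smul_right]
    refine mul_nonpos_of_nonneg_of_nonpos ?_ (hcd F hF)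
    have := F.2.inner_normalVec_le hfull (mem_vertFacets.1 hF) hx
    rw [inner_sub_right]
    linarith
  rw [inner_sub_right] at hle
  linarith

/-! ### Relations in the polytopal algebra -/

theorem polyMk_eq_zero_of_srIdeal {Q : Set V} (t : Finset (Facets Q))
    (ht : (⋂ F ∈ t, (F.1 : Set V)) = ∅) : polyMk Q (∏ F ∈ t, MvPolynomial.X F) = 0 :=
  Ideal.Quotient.eq_zero_iff_mem.2
    (Ideal.mem_sup_left (Ideal.subset_span ⟨t, ht, rfl⟩))

theorem sum_inner_smul_polyMk_X {Q : Set V} [Fintype (Facets Q)] (u : V) :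
    ∑ F : Facets Q, ⟪u, normalVec Q F.1⟫ • polyMk Q (MvPolynomial.X F) = 0 := by
  have h : polyMk Q (∑ᶠ F : Facets Q,
      MvPolynomial.C ⟪u, normalVec Q F.1⟫ * MvPolynomial.X F) = 0 :=
    Ideal.Quotient.eq_zero_iff_mem.2 (Ideal.mem_sup_right (Ideal.subset_span ⟨u, rfl⟩))
  rw [finsum_eq_sum_of_fintype, map_sum] at h
  rw [← h]
  refine Finset.sum_congr rfl fun F _ => ?_
  rw [← MvPolynomial.smul_eq_C_mul, map_smul]

/-- The vertex monomials of the two ends of an edge agree up to a positive scalar. -/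
theorem IsSimple.exists_adjacent [FiniteDimensional ℝ V] {Q : Set V} [Fintype (Facets Q)]
    (hQ : ∃ A : Set V, A.Finite ∧ Q = convexHull ℝ A) (hfull : (interior Q).Nonempty)
    (hsimple : IsSimple Q) {v d : V} (hv : v ∈ Set.extremePoints ℝ Q) {F : Facets Q}
    (hF : F ∈ vertFacets Q v) (hdF : ⟪normalVec Q F.1, d⟫ = -1)
    (hd : ∀ E ∈ vertFacets Q v, E ≠ F → ⟪normalVec Q E.1, d⟫ = 0) :
    ∃ t : ℝ, 0 < t ∧ v + t • d ∈ Set.extremePoints ℝ Q ∧ ∃ c : ℝ, 0 < c ∧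
      polyMk Q (vertMonomial Q v) = c • polyMk Q (vertMonomial Q (v + t • d)) := by
  classical
  have hcomp : IsCompact Q := by
    obtain ⟨A, hA, rfl⟩ := hQ
    exact hA.isCompact_convexHull ℝ
  have hd0 : d ≠ 0 := by
    rintro rfl
    simp at hdF
  have hddpos : 0 < ⟪d, d⟫ := real_inner_self_pos.2 hd0
  set S := (vertFacets Q v).erase F with hS
  have hSv : ∀ E ∈ S, v ∈ E.1 := fun E hE => mem_vertFacets.1 (Finset.mem_of_mem_erase hE)
  set e : Set V := {x ∈ Q | ∀ E ∈ S, x ∈ E.1} with he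
  -- Every point of the edge lies on the ray from `v` in direction `d`
  have heq : ∀ x ∈ e, ∃ s : ℝ, 0 ≤ s ∧ x = v + s • d := by
    intro x hx
    refine ⟨⟪normalVec Q F.1, v⟫ - ⟪normalVec Q F.1, x⟫, ?_, ?_⟩
    · linarith [F.2.inner_normalVec_le hfull (mem_vertFacets.1 hF) hx.1]
    · refine IsSimple.eq_of_inner_eq hQ hfull hv fun E hE => ?_
      rw [inner_add_right, inner_smul_right]
      by_cases hEF : E = F
      · rw [hEF, hdF]
        ring
      · rw [hd E hE hEF, (E.2.mem_iff hfull (mem_vertFacets.1 hE) hx.1).1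
          (hx.2 E (Finset.mem_erase.2 ⟨hEF, hE⟩))]
        ring
  have hmem_e : ∀ s : ℝ, v + s • d ∈ Q → v + s • d ∈ e := fun s hs =>
    ⟨hs, fun E hE => (E.2.mem_iff hfull (hSv E hE) hs).2 (by
      rw [inner_add_right, inner_smul_right, hd E (Finset.mem_of_mem_erase hE)
        (Finset.ne_of_mem_erase hE)]
      ring)⟩
  have hecomp : IsCompact e := by
    have : e = Q ∩ ⋂ E ∈ S, (E.1 : Set V) := by
      ext x
      simp [he]
    rw [this]
    refine hcomp.inter_right (isClosed_biInter fun E _ => ?_)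
    exact E.2.1.isClosed hcomp.isClosed
  have hve : v ∈ e := ⟨hv.1, hSv⟩
  obtain ⟨v', hv'e, hmax⟩ := hecomp.exists_isMaxOn ⟨v, hve⟩
    (f := fun x => ⟪d, x⟫) (by fun_prop)
  obtain ⟨t, -, rfl⟩ := heq v' hv'e
  have hle : ∀ s : ℝ, v + s • d ∈ Q → s ≤ t := by
    intro s hs
    have : ⟪d, v + s • d⟫ ≤ ⟪d, v + t • d⟫ := hmax (hmem_e s hs)
    rw [inner_add_right, inner_add_right, inner_smul_right, inner_smul_right] at this
    exact le_of_mul_le_mul_right (by linarith) hddpos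
  have ht : 0 < t := by
    obtain ⟨s, hs, hsQ⟩ := exists_add_smul_mem (u := d) hQ hfull hv fun E hE hvE => by
      by_cases hEF : (⟨E, hE⟩ : Facets Q) = F
      · have : E = F.1 := congrArg Subtype.val hEF
        rw [this, hdF]
        norm_num
      · exact (hd ⟨E, hE⟩ (mem_vertFacets.2 hvE) hEF).le
    exact hs.trans_le (hle s hsQ)
  have hv' : v + t • d ∈ Set.extremePoints ℝ Q := by
    refine mem_extremePoints_iff_left.2 ⟨hv'e.1, fun x hx y hy hxy => ?_⟩
    have hxe : x ∈ e := ⟨hx, fun E hE => E.2.1.isExtreme.2 hx hy (hv'e.2 E hE) hxy⟩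
    have hye : y ∈ e := ⟨hy, fun E hE =>
      E.2.1.isExtreme.right_mem_of_mem_openSegment hx hy (hv'e.2 E hE) hxy⟩
    obtain ⟨r, -, rfl⟩ := heq x hxe
    obtain ⟨s, -, rfl⟩ := heq y hye
    have hr := hle r hx
    have hs := hle s hy
    obtain ⟨a, b, ha, hb, hab, hcomb⟩ := hxy
    have h1 : a * r + b * s = t := by
      obtain rfl : b = 1 - a := by linarith
      have : (a * r + (1 - a) * s - t) • d = 0 := by
        have h2 : (a * r + (1 - a) * s - t) • d
            = (a • (v + r • d) + (1 - a) • (v + s • d)) - (v + t • d) := by module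
        rw [h2, hcomb, sub_self]
      linarith [(smul_eq_zero.1 this).resolve_right hd0]
    have h3 : a * (t - r) + b * (t - s) = 0 := by
      have : a * (t - r) + b * (t - s) = (a + b) * t - (a * r + b * s) := by ring
      rw [this, hab, h1]
      ring
    have h4 : a * (t - r) = 0 := by
      have := mul_nonneg ha.le (sub_nonneg.2 hr)
      have := mul_nonneg hb.le (sub_nonneg.2 hs)
      linarith
    have h5 : r = t := by linarith [(mul_eq_zero.1 h4).resolve_left ha.ne']
    rw [h5]
  refine ⟨t, ht, hv', ?_⟩
  have hFv' : F ∉ vertFacets Q (v + t • d) := by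
    intro h
    have := (F.2.mem_iff hfull (mem_vertFacets.1 hF) hv'.1).1 (mem_vertFacets.1 h)
    rw [inner_add_right, inner_smul_right, hdF] at this
    linarith
  have hSsub : S ⊆ vertFacets Q (v + t • d) := fun E hE => mem_vertFacets.2 (hv'e.2 E hE)
  have hcard : (vertFacets Q (v + t • d)).card = S.card + 1 := by
    rw [hsimple.card_vertFacets hv', ← hsimple.card_vertFacets hv, hS,
      Finset.card_erase_add_one hF]
  obtain ⟨G, hGS, hG⟩ : ∃ G, G ∉ S ∧ insert G S = vertFacets Q (v + t • d) := by
    obtain ⟨G, hG⟩ : ∃ G, vertFacets Q (v + t • d) \ S = {G} := by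
      rw [← Finset.card_eq_one, Finset.card_sdiff_of_subset hSsub]
      omega
    have hGmem : G ∈ vertFacets Q (v + t • d) \ S := by simp [hG]
    refine ⟨G, (Finset.mem_sdiff.1 hGmem).2, ?_⟩
    rw [Finset.insert_eq, ← hG, Finset.sdiff_union_of_subset hSsub]
  have hGv' : G ∈ vertFacets Q (v + t • d) := hG ▸ Finset.mem_insert_self G S
  have hGF : G ≠ F := fun h => hFv' (h ▸ hGv')
  have hGv : G ∉ vertFacets Q v := fun h => hGS (Finset.mem_erase.2 ⟨hGF, h⟩)
  have hdG : 0 < ⟪d, normalVec Q G.1⟫ := by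
    have h1 := G.2.inner_normalVec_le hfull (mem_vertFacets.1 hGv') hv.1
    have h2 : ⟪normalVec Q G.1, v⟫ ≠ ⟪normalVec Q G.1, v + t • d⟫ := fun h =>
      hGv (mem_vertFacets.2 ((G.2.mem_iff hfull (mem_vertFacets.1 hGv') hv.1).2 h))
    have h3 := lt_of_le_of_ne h1 h2
    rw [inner_add_right, inner_smul_right] at h3
    rw [real_inner_comm]
    exact (mul_pos_iff_of_pos_left ht).1 (by linarith)
  refine ⟨⟪d, normalVec Q G.1⟫, hdG, ?_⟩
  have hprod : ∀ H ∉ S, polyMk Q (MvPolynomial.X H) * polyMk Q (∏ E ∈ S, MvPolynomial.X E)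
      = polyMk Q (∏ E ∈ insert H S, MvPolynomial.X E) := fun H hH => by
    rw [Finset.prod_insert hH, map_mul]
  have hzero : ∀ H ∉ S, H ≠ F → H ≠ G →
      polyMk Q (∏ E ∈ insert H S, MvPolynomial.X E) = 0 := by
    intro H hHS hHF hHG
    have hHv : v ∉ H.1 := fun h => hHS (Finset.mem_erase.2 ⟨hHF, mem_vertFacets.2 h⟩)
    have hHv' : v + t • d ∉ H.1 := fun h => by
      have := mem_vertFacets.2 h
      rw [← hG, Finset.mem_insert] at this
      exact this.elim hHG hHS
    refine polyMk_eq_zero_of_srIdeal _ (Set.eq_empty_of_forall_notMem fun x hx => ?_)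
    rw [Set.mem_iInter₂] at hx
    have hxH : x ∈ H.1 := hx H (Finset.mem_insert_self H S)
    obtain ⟨s, hs, rfl⟩ := heq x ⟨H.2.subset hxH, fun E hE => hx E (Finset.mem_insert_of_mem hE)⟩
    rcases hs.eq_or_lt with rfl | hs
    · exact hHv (by simpa using hxH)
    rcases (hle s (H.2.subset hxH)).eq_or_lt with rfl | hst
    · exact hHv' hxH
    refine hHv (H.2.1.isExtreme.2 hv.1 hv'.1 hxH
      ⟨1 - s / t, s / t, ?_, by positivity, by ring, ?_⟩)
    · rw [sub_pos, div_lt_one ht]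
      exact hst
    · have : (1 - s / t) • v + (s / t) • (v + t • d) = v + (s / t * t) • d := by module
      rw [this, div_mul_cancel₀ _ ht.ne']
  have hFS : F ∉ S := Finset.notMem_erase F _
  have hsum := congrArg (· * polyMk Q (∏ E ∈ S, MvPolynomial.X E))
    (sum_inner_smul_polyMk_X (Q := Q) d)
  simp only [Finset.sum_mul, zero_mul, smul_mul_assoc] at hsum
  rw [Finset.sum_eq_add F G hGF.symm (fun H _ hH => ?_) (by simp) (by simp)] at hsum
  · rw [hprod F hFS, hprod G hGS, hG, hS, Finset.insert_erase hF, ← vertMonomial_eq_prod,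
      ← vertMonomial_eq_prod, real_inner_comm, hdF, neg_one_smul, neg_add_eq_zero] at hsum
    exact hsum
  · by_cases hHS : H ∈ S
    · rw [real_inner_comm, hd H (Finset.mem_of_mem_erase hHS) (Finset.ne_of_mem_erase hHS),
        zero_smul]
    · rw [hprod H hHS, hzero H hHS hH.1 hH.2, smul_zero]

/-- Lemma 5.4: in the polytopal algebra `𝒜(Q)` of a full-dimensional simple polytope,
the classes of the vertex monomials `∏_{F ∈ T_v} X_F` for any two extreme points
`v, w` agree up to a positive scalar. -/
theorem statement_16 {V : Type*} [NormedAddCommGroup V] [InnerProductSpace ℝ V]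
    [FiniteDimensional ℝ V] (hn : 1 ≤ Module.finrank ℝ V)
    (Q : Set V) (hQ : ∃ A : Set V, A.Finite ∧ Q = convexHull ℝ A)
    (hfull : (interior Q).Nonempty) (hsimple : IsSimple Q)
    (v w : V) (hv : v ∈ Set.extremePoints ℝ Q) (hw : w ∈ Set.extremePoints ℝ Q) :
    ∃ c : ℝ, 0 < c ∧
      polyMk Q (vertMonomial Q v) = c • polyMk Q (vertMonomial Q w) := by
  have := finite_facets hQ
  let _ : Fintype (Facets Q) := Fintype.ofFinite _
  -- A functional maximized over `Q` only at `w`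
  set φ : V := ∑ F ∈ vertFacets Q w, normalVec Q F.1
  have hφ : ∀ x ∈ Q, x ≠ w → ⟪φ, x⟫ < ⟪φ, w⟫ := by
    intro x hx hxw
    rw [sum_inner, sum_inner]
    have hle : ∀ F ∈ vertFacets Q w, ⟪normalVec Q F.1, x⟫ ≤ ⟪normalVec Q F.1, w⟫ :=
      fun F hF => F.2.inner_normalVec_le hfull (mem_vertFacets.1 hF) hx
    refine Finset.sum_lt_sum hle ?_
    by_contra! hcon
    exact hxw (IsSimple.eq_of_inner_eq hQ hfull hw fun F hF => (hle F hF).antisymm (hcon F hF))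
  by_contra hcon
  obtain ⟨x, ⟨hx, hxbad⟩, hxmax⟩ := Set.exists_max_image
    {x ∈ Set.extremePoints ℝ Q | ¬ ∃ c : ℝ, 0 < c ∧
      polyMk Q (vertMonomial Q x) = c • polyMk Q (vertMonomial Q w)}
    (fun x => ⟪φ, x⟫) ((finite_extremePoints hQ).subset (Set.sep_subset _ _)) ⟨v, hv, hcon⟩
  have hxw : x ≠ w := by
    rintro rfl
    exact hxbad ⟨1, one_pos, (one_smul _ _).symm⟩
  obtain ⟨F, hF, d, hdF, hd, hφd⟩ :=
    hsimple.exists_improving_edge hQ hfull hx hw.1 (hφ x hx.1 hxw)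
  obtain ⟨t, ht, hy, c, hc, hxy⟩ := hsimple.exists_adjacent hQ hfull hx hF hdF hd
  by_cases hybad : ∃ c : ℝ, 0 < c ∧
      polyMk Q (vertMonomial Q (x + t • d)) = c • polyMk Q (vertMonomial Q w)
  · obtain ⟨c', hc', hyw⟩ := hybad
    exact hxbad ⟨c * c', mul_pos hc hc', by rw [hxy, hyw, smul_smul]⟩
  · have h : ⟪φ, x + t • d⟫ ≤ ⟪φ, x⟫ := hxmax _ ⟨hy, hybad⟩
    rw [inner_add_right, inner_smul_right] at h
    nlinarith
end
end

section
/- Lemma (Lemma 6.3). Assume n = 3 and let K ⊆ {1, 2, 3}; the full-dimensional W-symmetric polytope P = conv(⋃_{w ∈ W} w(Λ)) is allowed to be degenerate. If P is a simple polytope, then the full-dimensional polytope P ∩ C_K is simple. -/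
open scoped RealInnerProductSpace

noncomputable section

variable {V : Type*} [NormedAddCommGroup V] [InnerProductSpace ℝ V]

/-- The cone `C_K = {x | ⟪x, α_k⟫ ≥ 0 for all k ∈ K}`. -/
def cham {n : ℕ} (α : Fin n → V) (K : Set (Fin n)) : Set V :=
  {x : V | ∀ k ∈ K, 0 ≤ ⟪x, α k⟫}

/-- The parabolic subgroup `W_K`, realized as the submonoid of `Function.End V`
generated by the simple reflections `r_{α_k}`, `k ∈ K` (since each generator is an
involution, this submonoid coincides with the generated group). -/
def WK {n : ℕ} (α : Fin n → V) (K : Set (Fin n)) : Submonoid (Function.End V) :=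
  Submonoid.closure {g : Function.End V | ∃ k ∈ K, g = reflMap (α k)}

/-- A reduced root system of full rank `n` in `V` with a fixed simple system `α`. -/
structure RootSystemData (V : Type*) [NormedAddCommGroup V] [InnerProductSpace ℝ V]
    (n : ℕ) : Type _ where
  α : Fin n → V
  R : Set V
  hn : 1 ≤ n
  hdim : Module.finrank ℝ V = n
  hR_fin : R.Finite
  hR_ne0 : ∀ β ∈ R, β ≠ 0
  hR_refl : ∀ β ∈ R, reflMap β '' R = R
  hR_red : ∀ β ∈ R, R ∩ {x : V | ∃ c : ℝ, x = c • β} = {β, -β}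
  hα_mem : ∀ i, α i ∈ R
  hα_indep : LinearIndependent ℝ α
  hα_span : Submodule.span ℝ (Set.range α) = ⊤
  hα_sign : ∀ β ∈ R, ∃ c : Fin n → ℝ, β = ∑ i, c i • α i ∧
    ((∀ i, 0 ≤ c i) ∨ (∀ i, c i ≤ 0))

/-- A `W`-symmetric polytope datum: a root system together with a finite nonempty
set `Λ` contained in the fundamental chamber `C_S`. -/
structure PermSetup (V : Type*) [NormedAddCommGroup V] [InnerProductSpace ℝ V]
    (n : ℕ) extends RootSystemData V n where
  Λ : Set V
  hΛ_fin : Λ.Finite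
  hΛ_ne : Λ.Nonempty
  hΛ_cham : Λ ⊆ cham α Set.univ

/-- The `W`-symmetric polytope `P = conv(⋃_{w ∈ W} w(Λ))`. -/
def PermSetup.P {n : ℕ} (S : PermSetup V n) : Set V :=
  convexHull ℝ (⋃ w ∈ WK S.α Set.univ, Set.image w S.Λ)

/-- `P` is nondegenerate: `⟪λ, α_i⟫ > 0` for every `λ ∈ Λ` and every `i`. -/
def PermSetup.Nondegenerate {n : ℕ} (S : PermSetup V n) : Prop :=
  ∀ l ∈ S.Λ, ∀ i, 0 < ⟪l, S.α i⟫

open Filter Topology Module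

/-- The points of `Q` at which `⟪u, ·⟫` takes the same value as at `v`. -/
def levelSet (Q : Set V) (u v : V) : Set V := {x ∈ Q | ⟪u, x⟫ = ⟪u, v⟫}

/-- The outward unit normals of the facets of `Q` that contain `v`. -/
def facetNormals (Q : Set V) (v : V) : Set V :=
  {u | ‖u‖ = 1 ∧ (∀ y ∈ Q, ⟪u, y⟫ ≤ ⟪u, v⟫) ∧
    finrank ℝ (vectorSpan ℝ (levelSet Q u v)) + 1 = finrank ℝ V}

lemma exists_pos_add_smul_mem {s : Set V} {p : V} (hs : s ∈ 𝓝 p) (d : V) {δ : ℝ} (hδ : 0 < δ) :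
    ∃ t : ℝ, 0 < t ∧ t < δ ∧ p + t • d ∈ s ∧ p - t • d ∈ s := by
  have h1 : Tendsto (fun t : ℝ => p + t • d) (𝓝[>] 0) (𝓝 p) := by
    have : Continuous fun t : ℝ => p + t • d := by fun_prop
    simpa using (this.tendsto 0).mono_left nhdsWithin_le_nhds
  have h2 : Tendsto (fun t : ℝ => p - t • d) (𝓝[>] 0) (𝓝 p) := by
    have : Continuous fun t : ℝ => p - t • d := by fun_prop
    simpa using (this.tendsto 0).mono_left nhdsWithin_le_nhds
  have h3 : ∀ᶠ t : ℝ in 𝓝[>] 0, t < δ := nhdsWithin_le_nhds (gt_mem_nhds hδ)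
  obtain ⟨t, ht⟩ := ((h1.eventually hs).and ((h2.eventually hs).and
    (h3.and self_mem_nhdsWithin))).exists
  exact ⟨t, ht.2.2.2, ht.2.2.1, ht.1, ht.2.1⟩

lemma eq_zero_of_forall_inner_le_of_mem_interior {Q : Set V} {p u : V} (hp : p ∈ interior Q)
    (h : ∀ y ∈ Q, ⟪u, y⟫ ≤ ⟪u, p⟫) : u = 0 := by
  obtain ⟨t, ht, -, h1, -⟩ := exists_pos_add_smul_mem (mem_interior_iff_mem_nhds.1 hp) u one_pos
  have := h _ h1
  rw [inner_add_right, inner_smul_right] at this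
  have h0 : ⟪u, u⟫ ≤ 0 := by
    by_contra! hc
    have := mul_pos ht hc
    linarith
  exact inner_self_eq_zero.1 (le_antisymm h0 real_inner_self_nonneg)

lemma isExposed_levelSet {Q : Set V} {u v : V} (hv : v ∈ Q) (h : ∀ y ∈ Q, ⟪u, y⟫ ≤ ⟪u, v⟫) :
    IsExposed ℝ Q (levelSet Q u v) := by
  intro _
  refine ⟨innerSL ℝ u, ?_⟩
  ext x
  simp only [levelSet, Set.mem_ofPred_eq, innerSL_apply_apply]
  constructor
  · rintro ⟨hx, e⟩
    exact ⟨hx, fun y hy => e ▸ h y hy⟩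
  · rintro ⟨hx, hm⟩
    exact ⟨hx, le_antisymm (h x hx) (hm v hv)⟩

lemma vectorSpan_levelSet_le (Q : Set V) (u v : V) :
    vectorSpan ℝ (levelSet Q u v) ≤ (ℝ ∙ u)ᗮ := by
  refine Submodule.span_le.2 ?_
  rintro _ ⟨x, hx, y, hy, rfl⟩
  rw [SetLike.mem_coe, Submodule.mem_orthogonal_singleton_iff_inner_right]
  simp only [vsub_eq_sub]
  rw [inner_sub_right, hx.2, hy.2, sub_self]

lemma levelSet_convexHull_eq {E : Set V} (hE : E.Finite) {u v : V} (hv : v ∈ convexHull ℝ E)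
    (h : ∀ y ∈ convexHull ℝ E, ⟪u, y⟫ ≤ ⟪u, v⟫) :
    levelSet (convexHull ℝ E) u v = convexHull ℝ (E ∩ levelSet (convexHull ℝ E) u v) := by
  have hexp := isExposed_levelSet hv h
  have hconv : Convex ℝ (levelSet (convexHull ℝ E) u v) := hexp.convex (convex_convexHull ℝ E)
  refine Set.Subset.antisymm ?_ (convexHull_min Set.inter_subset_right hconv)
  have hcomp := hexp.isCompact (hE.isCompact_convexHull ℝ)
  conv_lhs => rw [← closure_convexHull_extremePoints hcomp hconv]
  refine closure_minimal (convexHull_mono fun x hx => ⟨?_, hx.1⟩)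
    ((hE.subset Set.inter_subset_left).isClosed_convexHull ℝ)
  exact extremePoints_convexHull_subset (hexp.isExtreme.extremePoints_subset_extremePoints hx)

lemma exists_mem_extremePoints_facetNormals_subset {Q : Set V} (hQ : IsCompact Q) {v : V}
    (hv : v ∈ Q) :
    ∃ w ∈ Set.extremePoints ℝ Q, facetNormals Q v ⊆ facetNormals Q w := by
  set F : Set V := Q ∩ {x | ∀ u ∈ facetNormals Q v, ⟪u, x⟫ = ⟪u, v⟫} with hF
  have hcl : IsClosed {x : V | ∀ u ∈ facetNormals Q v, ⟪u, x⟫ = ⟪u, v⟫} := by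
    have : {x : V | ∀ u ∈ facetNormals Q v, ⟪u, x⟫ = ⟪u, v⟫} =
        ⋂ u ∈ facetNormals Q v, {x | ⟪u, x⟫ = ⟪u, v⟫} := by
      ext x
      simp
    rw [this]
    exact isClosed_biInter fun u _ => isClosed_eq (by fun_prop) continuous_const
  obtain ⟨w, hw⟩ := (hQ.inter_right hcl).extremePoints_nonempty ⟨v, hv, fun _ _ => rfl⟩
  have hext : IsExtreme ℝ Q F := by
    refine ⟨Set.inter_subset_left, ?_⟩
    rintro x hx y hy z ⟨-, hz⟩ ⟨a, b, ha, hb, hab, rfl⟩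
    refine ⟨hx, fun u hu => ?_⟩
    have h1 := hz u hu
    rw [inner_add_right, inner_smul_right, inner_smul_right] at h1
    have h2 := hu.2.1 x hx
    have h3 := mul_le_mul_of_nonneg_left (hu.2.1 y hy) hb.le
    refine le_antisymm h2 ?_
    have h4 : a * ⟪u, v⟫ ≤ a * ⟪u, x⟫ := by
      have : a * ⟪u, v⟫ + b * ⟪u, v⟫ = ⟪u, v⟫ := by rw [← add_mul, hab, one_mul]
      linarith
    exact le_of_mul_le_mul_left h4 ha
  refine ⟨w, hext.extremePoints_subset_extremePoints hw, fun u hu => ?_⟩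
  have hwu : ⟪u, w⟫ = ⟪u, v⟫ := hw.1.2 u hu
  refine ⟨hu.1, fun y hy => hwu ▸ hu.2.1 y hy, ?_⟩
  have : levelSet Q u w = levelSet Q u v := by simp only [levelSet, hwu]
  rw [this]
  exact hu.2.2

lemma eq_zero_of_forall_inner_eq_zero {ι : Type*} {b : ι → V}
    (hspan : Submodule.span ℝ (Set.range b) = ⊤) {x : V} (h : ∀ i, ⟪b i, x⟫ = 0) : x = 0 := by
  have : x ∈ (Submodule.span ℝ (Set.range b))ᗮ := by
    refine (Submodule.mem_orthogonal _ _).2 fun u hu => ?_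
    induction hu using Submodule.span_induction with
    | mem _ hu => obtain ⟨i, rfl⟩ := hu; exact h i
    | zero => simp
    | add _ _ _ _ h1 h2 => rw [inner_add_left, h1, h2, add_zero]
    | smul _ _ _ h1 => rw [real_inner_smul_left, h1, mul_zero]
  simpa [hspan] using this

lemma levelSet_smul (Q : Set V) (u v : V) {c : ℝ} (hc : c ≠ 0) :
    levelSet Q (c • u) v = levelSet Q u v := by
  simp [levelSet, real_inner_smul_left, hc]

section FiniteDimensional

variable [FiniteDimensional ℝ V]

lemma finrank_orthogonal_singleton_add_one {u : V} (hu : u ≠ 0) :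
    finrank ℝ (ℝ ∙ u)ᗮ + 1 = finrank ℝ V := by
  rw [← (ℝ ∙ u).finrank_add_finrank_orthogonal, finrank_span_singleton hu, add_comm]

lemma vectorSpan_levelSet_eq {Q : Set V} {u v : V} (hu : u ∈ facetNormals Q v) :
    vectorSpan ℝ (levelSet Q u v) = (ℝ ∙ u)ᗮ := by
  refine Submodule.eq_of_le_of_finrank_eq (vectorSpan_levelSet_le Q u v) ?_
  have h0 : u ≠ 0 := by
    rintro rfl
    simpa using hu.1
  have := finrank_orthogonal_singleton_add_one h0
  have := hu.2.2
  omega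

lemma eq_of_levelSet_eq {Q : Set V} (hQ : (interior Q).Nonempty) {u u' v v' : V}
    (hv : v ∈ Q) (hu : u ∈ facetNormals Q v) (hu' : u' ∈ facetNormals Q v')
    (h : levelSet Q u v = levelSet Q u' v') : u = u' := by
  have h1 : (ℝ ∙ u) = (ℝ ∙ u') := by
    rw [← Submodule.orthogonal_orthogonal (ℝ ∙ u), ← Submodule.orthogonal_orthogonal (ℝ ∙ u'),
      ← vectorSpan_levelSet_eq hu, ← vectorSpan_levelSet_eq hu', h]
  have h2 : u' ∈ (ℝ ∙ u) := h1 ▸ Submodule.mem_span_singleton_self u'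
  obtain ⟨c, rfl⟩ := Submodule.mem_span_singleton.1 h2
  have h3 : |c| = 1 := by
    have := hu'.1
    rwa [norm_smul, hu.1, mul_one, Real.norm_eq_abs] at this
  rcases eq_or_eq_neg_of_abs_eq h3 with rfl | rfl
  · simp
  · exfalso
    have hvl : v ∈ levelSet Q ((-1 : ℝ) • u) v' := h ▸ ⟨hv, rfl⟩
    obtain ⟨p, hp⟩ := hQ
    have hb : ∀ y ∈ Q, ⟪u, v⟫ ≤ ⟪u, y⟫ := by
      intro y hy
      have := hu'.2.1 y hy
      rw [← hvl.2] at this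
      simpa using this
    have : u = 0 := eq_zero_of_forall_inner_le_of_mem_interior hp fun y hy =>
      (hu.2.1 y hy).trans (hb p (interior_subset hp))
    subst this
    simpa using hu.1

lemma finite_setOf_exists_mem_facetNormals {E : Set V} (hE : E.Finite)
    (hi : (interior (convexHull ℝ E)).Nonempty) :
    {u | ∃ v ∈ convexHull ℝ E, u ∈ facetNormals (convexHull ℝ E) v}.Finite := by
  have key : ∀ u v, v ∈ convexHull ℝ E → u ∈ facetNormals (convexHull ℝ E) v →
      E ∩ levelSet (convexHull ℝ E) u v =
        {e | e ∈ E ∧ ∀ y ∈ convexHull ℝ E, ⟪u, y⟫ ≤ ⟪u, e⟫} := by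
    intro u v hv hu
    ext e
    constructor
    · rintro ⟨he, h⟩
      exact ⟨he, fun y hy => h.2 ▸ hu.2.1 y hy⟩
    · rintro ⟨he, h⟩
      have heP := subset_convexHull ℝ E he
      exact ⟨he, heP, le_antisymm (hu.2.1 e heP) (h v hv)⟩
  refine Set.Finite.of_finite_image
    (f := fun u => {e | e ∈ E ∧ ∀ y ∈ convexHull ℝ E, ⟪u, y⟫ ≤ ⟪u, e⟫})
    (hE.finite_subsets.subset ?_) ?_
  · rintro _ ⟨u, -, rfl⟩ e he
    exact he.1
  · rintro u ⟨v, hv, hu⟩ u' ⟨v', hv', hu'⟩ h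
    refine eq_of_levelSet_eq hi hv hu hu' ?_
    rw [levelSet_convexHull_eq hE hv hu.2.1, levelSet_convexHull_eq hE hv' hu'.2.1,
      key u v hv hu, key u' v' hv' hu']
    exact congrArg _ h

lemma exists_mem_interior_forall_notMem_affineSpan {Q E : Set V} (hE : E.Finite)
    (hQ : (interior Q).Nonempty) (x : V) :
    ∃ p ∈ interior Q, ∀ A ⊆ E, finrank ℝ (vectorSpan ℝ A) + 2 ≤ finrank ℝ V →
      p ∉ affineSpan ℝ (insert x A) := by
  borelize V
  by_contra! hcon
  let μ : MeasureTheory.Measure V := MeasureTheory.Measure.addHaar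
  have hpos : 0 < μ (interior Q) := isOpen_interior.measure_pos μ hQ
  have hsub : interior Q ⊆ ⋃ A ∈ {A | A ⊆ E ∧ finrank ℝ (vectorSpan ℝ A) + 2 ≤ finrank ℝ V},
      (affineSpan ℝ (insert x A) : Set V) := by
    intro p hp
    obtain ⟨A, hA, hr, hm⟩ := hcon p hp
    exact Set.mem_biUnion (show A ∈ {A | _ ∧ _} from ⟨hA, hr⟩) hm
  have hnull : μ (⋃ A ∈ {A | A ⊆ E ∧ finrank ℝ (vectorSpan ℝ A) + 2 ≤ finrank ℝ V},
      (affineSpan ℝ (insert x A) : Set V)) = 0 := by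
    refine (MeasureTheory.measure_biUnion_null_iff
      (hE.finite_subsets.subset fun A hA => hA.1).countable).2 ?_
    rintro A ⟨-, hr⟩
    refine MeasureTheory.Measure.addHaar_affineSubspace μ _ fun htop => ?_
    have h1 := finrank_vectorSpan_insert_le_set ℝ A x
    rw [← direction_affineSpan, htop, AffineSubspace.direction_top, finrank_top] at h1
    omega
  exact absurd (MeasureTheory.measure_mono_null hsub hnull) hpos.ne'

lemma exists_facetNormal_of_notMem_convexHull {E : Set V} (hE : E.Finite)
    (hi : (interior (convexHull ℝ E)).Nonempty) {x : V} (hx : x ∉ convexHull ℝ E) :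
    ∃ y ∈ convexHull ℝ E, ∃ u ∈ facetNormals (convexHull ℝ E) y, ⟪u, y⟫ < ⟪u, x⟫ := by
  obtain ⟨p, hp, hgen⟩ := exists_mem_interior_forall_notMem_affineSpan hE hi x
  set P := convexHull ℝ E with hP
  have hconv : Convex ℝ P := convex_convexHull ℝ E
  have hcl : IsClosed P := hE.isClosed_convexHull ℝ
  have hcont : Continuous fun t : ℝ => p + t • (x - p) := by fun_prop
  have hTc : IsCompact (Set.Icc (0 : ℝ) 1 ∩ (fun t : ℝ => p + t • (x - p)) ⁻¹' P) :=
    isCompact_Icc.inter_right (hcl.preimage hcont)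
  obtain ⟨t, ⟨ht, htP⟩, htmax⟩ := hTc.exists_isMaxOn
    ⟨0, ⟨le_rfl, zero_le_one⟩, by simpa using interior_subset hp⟩ continuous_id.continuousOn
  simp only [Set.mem_preimage] at htP
  have ht1 : t < 1 := by
    refine lt_of_le_of_ne ht.2 ?_
    rintro rfl
    exact hx (by simpa using htP)
  set y := p + t • (x - p) with hy
  have hyi : y ∉ interior P := by
    intro hyi
    obtain ⟨s, hs, hs1, hsP, -⟩ := exists_pos_add_smul_mem (mem_interior_iff_mem_nhds.1 hyi)
      (x - p) (sub_pos.2 ht1)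
    have : s + t ≤ t := htmax ⟨⟨by linarith [ht.1], by linarith⟩, by
      simp only [Set.mem_preimage]
      convert hsP using 1
      rw [hy]
      module⟩
    linarith
  obtain ⟨f, hf⟩ := geometric_hahn_banach_open_point hconv.interior isOpen_interior hyi
  set u₀ := (InnerProductSpace.toDual ℝ V).symm f with hu₀
  have hfu : ∀ z, f z = ⟪u₀, z⟫ := fun z => by
    rw [hu₀, InnerProductSpace.toDual_symm_apply]
  have hu₀0 : u₀ ≠ 0 := by
    intro h0
    have := hf p hp
    simp [hfu, h0] at this
  have hfP : ∀ z ∈ P, ⟪u₀, z⟫ ≤ ⟪u₀, y⟫ := by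
    intro z hz
    have hz' : z ∈ closure (interior P) := by
      rw [hconv.closure_interior_eq_closure_of_nonempty_interior hi]
      exact subset_closure hz
    have hc : IsClosed {z | f z ≤ f y} := isClosed_le f.continuous continuous_const
    have h1 : f z ≤ f y := closure_minimal (fun a ha => (hf a ha).le) hc hz'
    rwa [hfu, hfu] at h1
  have hn : 0 < ‖u₀‖⁻¹ := inv_pos.2 (norm_pos_iff.2 hu₀0)
  set u := ‖u₀‖⁻¹ • u₀ with hu
  have huP : ∀ z ∈ P, ⟪u, z⟫ ≤ ⟪u, y⟫ := by
    intro z hz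
    simp only [hu, real_inner_smul_left]
    exact mul_le_mul_of_nonneg_left (hfP z hz) hn.le
  have hu1 : ‖u‖ = 1 := by
    rw [hu, norm_smul, norm_inv, norm_norm, inv_mul_cancel₀ (norm_ne_zero_iff.2 hu₀0)]
  have hu0 : u ≠ 0 := by
    rintro h0
    rw [h0] at hu1
    simp at hu1
  have hlt : ⟪u₀, y⟫ < ⟪u₀, x⟫ := by
    have h1 := hf p hp
    rw [hfu, hfu, hy, inner_add_right, inner_smul_right, inner_sub_right] at h1
    rw [hy, inner_add_right, inner_smul_right, inner_sub_right]
    have h2 : 0 < ⟪u₀, x⟫ - ⟪u₀, p⟫ := by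
      by_contra! hc
      have := mul_nonpos_of_nonneg_of_nonpos ht.1 hc
      linarith
    nlinarith
  refine ⟨y, htP, u, ⟨hu1, huP, ?_⟩, ?_⟩
  · have hle := Submodule.finrank_mono (vectorSpan_levelSet_le P u y)
    have hor := finrank_orthogonal_singleton_add_one hu0
    by_contra hne
    have heq := levelSet_convexHull_eq hE htP huP
    have hvs : vectorSpan ℝ (levelSet P u y) = vectorSpan ℝ (E ∩ levelSet P u y) := by
      conv_lhs => rw [heq]
      rw [← direction_affineSpan, affineSpan_convexHull, direction_affineSpan]
    refine hgen (E ∩ levelSet P u y) Set.inter_subset_left (by rw [← hvs]; omega) ?_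
    have hyA : y ∈ affineSpan ℝ (insert x (E ∩ levelSet P u y)) := by
      have h1 : y ∈ levelSet P u y := ⟨htP, rfl⟩
      rw [heq] at h1
      exact affineSpan_mono ℝ (Set.subset_insert _ _) (convexHull_subset_affineSpan _ h1)
    have hxA : x ∈ affineSpan ℝ (insert x (E ∩ levelSet P u y)) :=
      subset_affineSpan ℝ _ (Set.mem_insert _ _)
    have hpl : p = AffineMap.lineMap y x (-(t / (1 - t))) := by
      have h1t : 1 - t ≠ 0 := by linarith
      have hxy : x - y = (1 - t) • (x - p) := by rw [hy]; module
      rw [AffineMap.lineMap_apply, vsub_eq_sub, vadd_eq_add, hxy, smul_smul, neg_mul,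
        div_mul_cancel₀ _ h1t, hy]
      module
    rw [hpl]
    exact AffineMap.lineMap_mem _ hyA hxA
  · simp only [hu, real_inner_smul_left]
    exact mul_lt_mul_of_pos_left hlt hn

lemma eventually_mem_convexHull_iff {E : Set V} (hE : E.Finite)
    (hi : (interior (convexHull ℝ E)).Nonempty) {v : V} (hv : v ∈ convexHull ℝ E) :
    ∀ᶠ x in 𝓝 v, x ∈ convexHull ℝ E ↔
      ∀ u ∈ facetNormals (convexHull ℝ E) v, ⟪u, x - v⟫ ≤ 0 := by
  set P := convexHull ℝ E with hP
  have hfin := finite_setOf_exists_mem_facetNormals hE hi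
  have hev : ∀ᶠ x in 𝓝 v, ∀ u ∈ {u | ∃ v ∈ P, u ∈ facetNormals P v},
      u ∉ facetNormals P v → ∀ y ∈ P, u ∈ facetNormals P y → ⟪u, x⟫ < ⟪u, y⟫ := by
    refine (Filter.eventually_all_finite hfin).2 ?_
    rintro u ⟨y₀, hy₀, huy₀⟩
    by_cases huv : u ∈ facetNormals P v
    · simp [huv]
    · have hlt : ⟪u, v⟫ < ⟪u, y₀⟫ := by
        refine lt_of_le_of_ne (huy₀.2.1 v hv) fun heq => huv ?_
        refine ⟨huy₀.1, fun y hy => heq ▸ huy₀.2.1 y hy, ?_⟩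
        have : levelSet P u v = levelSet P u y₀ := by simp only [levelSet, heq]
        rw [this]
        exact huy₀.2.2
      have hc : Continuous fun x : V => ⟪u, x⟫ := by fun_prop
      filter_upwards [(hc.tendsto v).eventually (gt_mem_nhds hlt)] with x hx _ y hy huy
      exact hx.trans_le (huy.2.1 y₀ hy₀)
  filter_upwards [hev] with x hx
  constructor
  · intro hxP u hu
    rw [inner_sub_right]
    linarith [hu.2.1 x hxP]
  · intro h
    by_contra hxP
    obtain ⟨y, hy, u, hu, hlt⟩ := exists_facetNormal_of_notMem_convexHull hE hi hxP
    by_cases huv : u ∈ facetNormals P v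
    · have h1 := h u huv
      rw [inner_sub_right] at h1
      linarith [hu.2.1 v hv]
    · exact absurd (hx u ⟨y, hy, hu⟩ huv y hy hu) hlt.not_gt

lemma span_eq_top_of_mem_extremePoints {Q G : Set V} {v : V} (hv : v ∈ Set.extremePoints ℝ Q)
    (hG : ∀ᶠ x in 𝓝 v, (∀ g ∈ G, ⟪g, x - v⟫ ≤ 0) → x ∈ Q) : Submodule.span ℝ G = ⊤ := by
  rw [← Submodule.orthogonal_eq_bot_iff, Submodule.eq_bot_iff]
  intro y hy
  have hyG : ∀ g ∈ G, ⟪g, y⟫ = 0 := fun g hg =>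
    (Submodule.mem_orthogonal _ _).1 hy g (Submodule.subset_span hg)
  obtain ⟨t, ht, -, h1, h2⟩ := exists_pos_add_smul_mem hG y one_pos
  have hm1 : v + t • y ∈ Q := h1 fun g hg => by simp [inner_smul_right, hyG g hg]
  have hm2 : v - t • y ∈ Q := h2 fun g hg => by simp [inner_smul_right, hyG g hg]
  have := hv.2 hm1 hm2 ⟨1 / 2, 1 / 2, by norm_num, by norm_num, by norm_num, by module⟩
  simpa [ht.ne'] using this

lemma IsSimple.linearIndepOn_facetNormals [Nontrivial V] {E : Set V} (hE : E.Finite)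
    (hi : (interior (convexHull ℝ E)).Nonempty) (hs : IsSimple (convexHull ℝ E)) {v : V}
    (hv : v ∈ convexHull ℝ E) : LinearIndepOn ℝ id (facetNormals (convexHull ℝ E) v) := by
  obtain ⟨w, hw, hsub⟩ :=
    exists_mem_extremePoints_facetNormals_subset (hE.isCompact_convexHull ℝ) hv
  refine LinearIndepOn.mono ?_ hsub
  set P := convexHull ℝ E
  have hfin : (facetNormals P w).Finite :=
    (finite_setOf_exists_mem_facetNormals hE hi).subset fun u hu => ⟨w, hw.1, hu⟩
  have hcard : (facetNormals P w).ncard ≤ finrank ℝ V := by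
    rw [← hs w hw]
    refine Set.ncard_le_ncard_of_injOn (fun u => levelSet P u w) ?_ ?_
      (Set.finite_of_ncard_pos (by rw [hs w hw]; exact finrank_pos))
    · intro u hu
      refine ⟨⟨isExposed_levelSet hw.1 hu.2.1, ?_⟩, hw.1, rfl⟩
      rw [direction_affineSpan]
      exact hu.2.2
    · intro u hu u' hu' h
      exact eq_of_levelSet_eq hi hw.1 hu hu' h
  have hspan : Submodule.span ℝ (facetNormals P w) = ⊤ :=
    span_eq_top_of_mem_extremePoints hw
      ((eventually_mem_convexHull_iff hE hi hw.1).mono fun x hx => hx.2)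
  have := hfin.fintype
  refine linearIndependent_of_top_le_span_of_card_le_finrank ?_ ?_
  · simpa using hspan.ge
  · rwa [← Nat.card_eq_fintype_card, Nat.card_coe_set_eq]

lemma exists_dual_of_linearIndependent {ι : Type*} [DecidableEq ι] {b : ι → V}
    (hb : LinearIndependent ℝ b) :
    ∃ d : ι → V, ∀ i j, ⟪b i, d j⟫ = if i = j then 1 else 0 := by
  have h : ∀ j, ∃ g : V →ₗ[ℝ] ℝ, g ∘ₗ (Submodule.span ℝ (Set.range b)).subtype =
      (Basis.span hb).coord j := fun j => LinearMap.exists_extend _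
  choose g hg using h
  refine ⟨fun j => (InnerProductSpace.toDual ℝ V).symm (LinearMap.toContinuousLinearMap (g j)),
    fun i j => ?_⟩
  rw [real_inner_comm, InnerProductSpace.toDual_symm_apply, LinearMap.coe_toContinuousLinearMap']
  have h1 : b i = (Submodule.span ℝ (Set.range b)).subtype (Basis.span hb i) := by
    rw [Submodule.subtype_apply, Basis.span_apply]
  rw [h1, ← LinearMap.comp_apply, hg, Basis.coord_apply, Basis.repr_self, Finsupp.single_apply]

lemma ncard_facets_of_eventually_mem_iff {ι : Type*} [Fintype ι] {Q : Set V}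
    (hQ : Convex ℝ Q) {v : V} (hv : v ∈ Q) {b : ι → V} (hb : LinearIndependent ℝ b)
    (hspan : Submodule.span ℝ (Set.range b) = ⊤)
    (hloc : ∀ᶠ x in 𝓝 v, x ∈ Q ↔ ∀ i, ⟪b i, x - v⟫ ≤ 0) :
    {F : Set V | IsFacet Q F ∧ v ∈ F}.ncard = finrank ℝ V := by
  classical
  obtain ⟨d, hd⟩ := exists_dual_of_linearIndependent hb
  have hrep : ∀ x, x = ∑ j, ⟪b j, x⟫ • d j := by
    intro x
    refine sub_eq_zero.1 (eq_zero_of_forall_inner_eq_zero hspan fun i => ?_)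
    simp [inner_sub_right, inner_sum, inner_smul_right, hd]
  have hglob : ∀ x ∈ Q, ∀ i, ⟪b i, x - v⟫ ≤ 0 := by
    intro x hx i
    obtain ⟨t, ht, ht1, h, -⟩ := exists_pos_add_smul_mem hloc (x - v) one_pos
    have h1 : v + t • (x - v) ∈ Q := hQ.add_smul_sub_mem hv hx ⟨ht.le, ht1.le⟩
    have h2 := h.1 h1 i
    rw [add_sub_cancel_left, inner_smul_right] at h2
    exact nonpos_of_mul_nonpos_right h2 ht
  have hglob' : ∀ x ∈ Q, ∀ i, ⟪b i, x⟫ ≤ ⟪b i, v⟫ := fun x hx i => by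
    have := hglob x hx i
    rwa [inner_sub_right, sub_nonpos] at this
  have hdmem : ∀ j, ∃ t : ℝ, 0 < t ∧ v - t • d j ∈ Q := by
    intro j
    obtain ⟨t, ht, -, -, h⟩ := exists_pos_add_smul_mem hloc (d j) one_pos
    refine ⟨t, ht, h.2 fun i => ?_⟩
    rw [sub_sub_cancel_left, inner_neg_right, inner_smul_right, hd]
    split_ifs <;> simp [ht.le]
  choose t ht htQ using hdmem
  have hdspan : ∀ F : Set V, v ∈ F → ∀ j, v - t j • d j ∈ F → d j ∈ vectorSpan ℝ F := by
    intro F hvF j hj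
    have h1 := (vectorSpan ℝ F).smul_mem (t j)⁻¹ (vsub_mem_vectorSpan ℝ hvF hj)
    rwa [vsub_eq_sub, sub_sub_cancel, inv_smul_smul₀ (ht j).ne'] at h1
  have hb0 : ∀ i, b i ≠ 0 := fun i => hb.ne_zero i
  have hinner : ∀ i j, ⟪b i, v - t j • d j⟫ = ⟪b i, v⟫ - if i = j then t j else 0 := by
    intro i j
    rw [inner_sub_right, inner_smul_right, hd]
    simp
  have hfacet : ∀ i, IsFacet Q (levelSet Q (b i) v) := by
    intro i
    refine ⟨isExposed_levelSet hv fun y hy => hglob' y hy i, ?_⟩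
    have heq : vectorSpan ℝ (levelSet Q (b i) v) = (ℝ ∙ b i)ᗮ := by
      refine le_antisymm (vectorSpan_levelSet_le _ _ _) fun y hy => ?_
      rw [Submodule.mem_orthogonal_singleton_iff_inner_right] at hy
      rw [hrep y]
      refine Submodule.sum_mem _ fun j _ => ?_
      by_cases hij : i = j
      · rw [← hij, hy, zero_smul]
        exact Submodule.zero_mem _
      · exact Submodule.smul_mem _ _
          (hdspan (levelSet Q (b i) v) ⟨hv, rfl⟩ j ⟨htQ j, by simp [hinner, hij]⟩)
    rw [direction_affineSpan, heq]
    exact finrank_orthogonal_singleton_add_one (hb0 i)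
  have hinj : Function.Injective fun i => levelSet Q (b i) v := by
    intro i j hij
    by_contra hne
    have h1 : v - t j • d j ∈ levelSet Q (b i) v := ⟨htQ j, by simp [hinner, hne]⟩
    have h2 : v - t j • d j ∈ levelSet Q (b j) v := by
      rw [← show levelSet Q (b i) v = levelSet Q (b j) v from hij]
      exact h1
    have h3 := h2.2
    rw [hinner, if_pos rfl] at h3
    linarith [ht j]
  have hset : {F : Set V | IsFacet Q F ∧ v ∈ F} = Set.range fun i => levelSet Q (b i) v := by
    ext F
    constructor
    · rintro ⟨⟨hexp, hdim⟩, hvF⟩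
      rw [direction_affineSpan] at hdim
      obtain ⟨l, rfl⟩ := hexp ⟨v, hvF⟩
      set w := (InnerProductSpace.toDual ℝ V).symm l with hw
      have hlw : ∀ z, l z = ⟪w, z⟫ := fun z => by
        rw [hw, InnerProductSpace.toDual_symm_apply]
      have hwv : ∀ y ∈ Q, ⟪w, y⟫ ≤ ⟪w, v⟫ := fun y hy => by
        rw [← hlw, ← hlw]
        exact hvF.2 y hy
      have hF : {x | x ∈ Q ∧ ∀ y ∈ Q, l y ≤ l x} = levelSet Q w v := by
        ext x
        simp only [levelSet, Set.mem_ofPred_eq, hlw]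
        constructor
        · rintro ⟨hx, hm⟩
          exact ⟨hx, le_antisymm (hwv x hx) (hm v hv)⟩
        · rintro ⟨hx, e⟩
          exact ⟨hx, fun y hy => e ▸ hwv y hy⟩
      rw [hF] at hdim ⊢
      have hc : ∀ j, 0 ≤ ⟪w, d j⟫ := by
        intro j
        have := hwv _ (htQ j)
        rw [inner_sub_right, inner_smul_right] at this
        have h1 : 0 ≤ t j * ⟪w, d j⟫ := by linarith
        exact nonneg_of_mul_nonneg_right h1 (ht j)
      have hwx : ∀ x, ⟪w, x⟫ = ∑ j, ⟪b j, x⟫ * ⟪w, d j⟫ := by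
        intro x
        conv_lhs => rw [hrep x, inner_sum]
        simp [inner_smul_right]
      have hw0 : w ≠ 0 := by
        intro h0
        have htop : vectorSpan ℝ (levelSet Q w v) = ⊤ := by
          refine eq_top_iff.2 fun y _ => ?_
          rw [hrep y]
          exact Submodule.sum_mem _ fun j _ => Submodule.smul_mem _ _
            (hdspan (levelSet Q w v) ⟨hv, rfl⟩ j ⟨htQ j, by simp [h0]⟩)
        rw [htop, finrank_top] at hdim
        omega
      obtain ⟨j, hj⟩ : ∃ j, ⟪w, d j⟫ ≠ 0 := by
        by_contra! hcon
        have := hwx w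
        simp only [hcon, mul_zero, Finset.sum_const_zero] at this
        exact hw0 (inner_self_eq_zero.1 this)
      have hsub : levelSet Q w v ⊆ levelSet Q (b j) v := by
        rintro x ⟨hx, hxw⟩
        refine ⟨hx, ?_⟩
        have h1 := hwx (x - v)
        rw [inner_sub_right, hxw, sub_self] at h1
        have h2 := (Finset.sum_eq_zero_iff_of_nonpos fun i _ =>
          mul_nonpos_of_nonpos_of_nonneg (hglob x hx i) (hc i)).1 h1.symm j (Finset.mem_univ j)
        have h3 := (mul_eq_zero.1 h2).resolve_right hj
        rwa [inner_sub_right, sub_eq_zero] at h3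
      have hle1 := (vectorSpan_mono ℝ hsub).trans (vectorSpan_levelSet_le Q (b j) v)
      have e1 : vectorSpan ℝ (levelSet Q w v) = (ℝ ∙ b j)ᗮ :=
        Submodule.eq_of_le_of_finrank_eq hle1 (by
          have := finrank_orthogonal_singleton_add_one (hb0 j)
          omega)
      have e2 : vectorSpan ℝ (levelSet Q w v) = (ℝ ∙ w)ᗮ :=
        Submodule.eq_of_le_of_finrank_eq (vectorSpan_levelSet_le Q w v) (by
          have := finrank_orthogonal_singleton_add_one hw0
          omega)
      have e3 : (ℝ ∙ b j) = (ℝ ∙ w) := by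
        rw [← Submodule.orthogonal_orthogonal (ℝ ∙ b j), ← e1, e2,
          Submodule.orthogonal_orthogonal]
      obtain ⟨c, hcw⟩ := Submodule.mem_span_singleton.1
        (e3 ▸ Submodule.mem_span_singleton_self (b j))
      refine ⟨j, ?_⟩
      have hc0 : c ≠ 0 := by
        rintro rfl
        exact hb0 j (by rw [← hcw, zero_smul])
      simp only [← hcw]
      exact levelSet_smul Q w v hc0
    · rintro ⟨i, rfl⟩
      exact ⟨hfacet i, hv, rfl⟩
  rw [hset, ← Set.image_univ, Set.ncard_image_of_injective _ hinj, Set.ncard_univ,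
    Nat.card_eq_fintype_card]
  exact (finrank_eq_card_basis (Basis.mk hb hspan.ge)).symm

lemma ncard_dominant_add_card_le {ι : Type*} [Fintype ι] {N : Set V}
    (hN : LinearIndepOn ℝ id N) {a : ι → V} (ha : LinearIndependent ℝ a)
    (hobt : ∀ i j, i ≠ j → ⟪a i, a j⟫ ≤ 0) (hrefl : ∀ k, ∀ u ∈ N, reflMap (a k) u ∈ N) :
    {u ∈ N | ∀ k, 0 ≤ ⟪u, a k⟫}.ncard + Fintype.card ι ≤ finrank ℝ V := by
  classical
  have hNfin : N.Finite := hN.linearIndependent.setFinite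
  have hpos : ∀ k, 0 < ⟪a k, a k⟫ := fun k => real_inner_self_pos.2 (ha.ne_zero k)
  set T : Set ι := {k | ∃ u ∈ N, ⟪u, a k⟫ ≠ 0} with hT
  have hneg : ∀ k ∈ T, ∃ b ∈ N, ⟪b, a k⟫ < 0 := by
    rintro k ⟨u, hu, hne⟩
    rcases hne.lt_or_gt with h | h
    · exact ⟨u, hu, h⟩
    · refine ⟨reflMap (a k) u, hrefl k u hu, ?_⟩
      rw [reflMap, inner_sub_left, real_inner_smul_left, div_mul_cancel₀ _ (hpos k).ne']
      linarith
  choose! b hbN hbneg using hneg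
  have hinj : Set.InjOn b T := by
    intro i hi j hj hij
    by_contra hne
    obtain ⟨δ, hδ⟩ := exists_dual_of_linearIndependent hN.linearIndependent
    have hδ' : ∀ u (hu : u ∈ N) w (hw : w ∈ N), ⟪u, δ ⟨w, hw⟩⟫ = if u = w then 1 else 0 := by
      intro u hu w hw
      simpa using hδ ⟨u, hu⟩ ⟨w, hw⟩
    have h1 := hbneg i hi
    have h2 := hbneg j hj
    rw [← hij] at h2
    set β := b i
    have hβ : β ∈ N := hbN i hi
    set s := 2 * ⟪β, a i⟫ / ⟪a i, a i⟫ with hs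
    set s' := 2 * ⟪β, a j⟫ / ⟪a j, a j⟫ with hs'
    have hs0 : s < 0 := div_neg_of_neg_of_pos (by linarith) (hpos i)
    have hs0' : s' < 0 := div_neg_of_neg_of_pos (by linarith) (hpos j)
    have hA : β - s • a i ∈ N := hrefl i β hβ
    have hC : β - s' • a j ∈ N := hrefl j β hβ
    have hD := hrefl i _ hC
    set r := 2 * ⟪β - s' • a j, a i⟫ / ⟪a i, a i⟫ with hr
    have hD' : β - s' • a j - r • a i ∈ N := hD
    have hai : a i ≠ 0 := ha.ne_zero i
    have haj : a j ≠ 0 := ha.ne_zero j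
    have hAB : β - s • a i ≠ β := by simp [hs0.ne, hai]
    have hCB : β - s' • a j ≠ β := by simp [hs0'.ne, haj]
    have hAC : β - s' • a j ≠ β - s • a i := by
      intro h
      have h' : s' • a j - s • a i = 0 := by
        rw [sub_right_inj] at h
        rw [h, sub_self]
      obtain ⟨d, hd⟩ := exists_dual_of_linearIndependent ha
      have := congrArg (fun x => ⟪x, d j⟫) h'
      simp only [inner_sub_left, real_inner_smul_left, hd, inner_zero_left, if_neg hne] at this
      simp [hs0'.ne] at this
    have hr0 : r = 0 := by
      have e : β - s' • a j - r • a i =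
          (β - s' • a j) + (r / s) • ((β - s • a i) - β) := by
        have : r • a i = (r / s) • s • a i := by rw [smul_smul, div_mul_cancel₀ _ hs0.ne]
        rw [this]
        module
      have i1 := congrArg (fun x => ⟪x, δ ⟨β, hβ⟩⟫) e
      have i2 := congrArg (fun x => ⟪x, δ ⟨β - s • a i, hA⟩⟫) e
      simp only [inner_add_left, real_inner_smul_left] at i1 i2
      rw [inner_sub_left (β - s • a i) β] at i1 i2
      rw [hδ' _ hD', hδ' _ hC, hδ' _ hA, hδ' _ hβ, if_neg hCB, if_neg hAB, if_pos rfl] at i1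
      rw [hδ' _ hD', hδ' _ hC, hδ' _ hA, hδ' _ hβ, if_neg hAC, if_neg hAB.symm,
        if_pos rfl] at i2
      have : r / s = 0 := by
        split_ifs at i1 i2 <;> linarith
      rcases div_eq_zero_iff.1 this with h | h
      · exact h
      · exact absurd h hs0.ne
    have h3 : ⟪β - s' • a j, a i⟫ = 0 := by
      rcases div_eq_zero_iff.1 hr0 with h | h
      · linarith
      · exact absurd h (hpos i).ne'
    rw [inner_sub_left, real_inner_smul_left] at h3
    have h4 := mul_nonneg_of_nonpos_of_nonpos hs0'.le (hobt j i (Ne.symm hne))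
    linarith
  have hcard1 : {u ∈ N | ∀ k, 0 ≤ ⟪u, a k⟫}.ncard + T.ncard ≤ N.ncard := by
    rw [← hinj.ncard_image, ← Set.ncard_union_eq ?_ (hNfin.subset fun u hu => hu.1)
      (T.toFinite.image b)]
    · refine Set.ncard_le_ncard (Set.union_subset (fun u hu => hu.1) ?_) hNfin
      rintro _ ⟨k, hk, rfl⟩
      exact hbN k hk
    · refine Set.disjoint_left.2 ?_
      rintro _ hu ⟨k, hk, rfl⟩
      exact absurd (hu.2 k) (hbneg k hk).not_ge
  have hcard2 : N.ncard + Tᶜ.ncard ≤ finrank ℝ V := by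
    have := hNfin.fintype
    have hli : LinearIndependent ℝ
        (Sum.elim (fun u : N => (u : V)) (fun k : (Tᶜ : Set ι) => a k)) := by
      refine LinearIndependent.sum_type hN.linearIndependent
        (ha.comp _ Subtype.val_injective) ?_
      refine Submodule.IsOrtho.disjoint (Submodule.isOrtho_span.2 ?_)
      rintro _ ⟨u, rfl⟩ _ ⟨k, rfl⟩
      by_contra h
      exact k.2 ⟨u, u.2, h⟩
    have h := hli.fintype_card_le_finrank
    rwa [Fintype.card_sum, ← Nat.card_eq_fintype_card, ← Nat.card_eq_fintype_card,
      Nat.card_coe_set_eq, Nat.card_coe_set_eq] at h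
  have hcard3 := Set.ncard_add_ncard_compl T
  rw [Nat.card_eq_fintype_card] at hcard3
  omega

end FiniteDimensional

lemma inner_nonpos_of_forall_dominant {ι : Type*} {N : Set V} (hN : N.Finite) {a : ι → V}
    (hrefl : ∀ k, ∀ u ∈ N, reflMap (a k) u ∈ N) {ρ : V} (hρ : ∀ k, 0 < ⟪ρ, a k⟫) {x : V}
    (hx : ∀ k, 0 ≤ ⟪x, a k⟫) (hdom : ∀ u ∈ N, (∀ k, 0 ≤ ⟪u, a k⟫) → ⟪u, x⟫ ≤ 0) :
    ∀ u ∈ N, ⟪u, x⟫ ≤ 0 := by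
  by_contra! hcon
  obtain ⟨u₀, hu₀, hpos₀⟩ := hcon
  obtain ⟨u, ⟨huN, hu⟩, hmax⟩ := Set.exists_max_image {u ∈ N | 0 < ⟪u, x⟫} (fun u => ⟪ρ, u⟫)
    (hN.subset fun u hu => hu.1) ⟨u₀, hu₀, hpos₀⟩
  obtain ⟨k, hk⟩ : ∃ k, ⟪u, a k⟫ < 0 := by
    by_contra! h
    exact absurd (hdom u huN h) hu.not_ge
  have ha : 0 < ⟪a k, a k⟫ := real_inner_self_pos.2 fun h => by
    have := hρ k
    simp [h] at this
  have hs : 2 * ⟪u, a k⟫ / ⟪a k, a k⟫ < 0 := div_neg_of_neg_of_pos (by linarith) ha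
  have h1 : 0 < ⟪reflMap (a k) u, x⟫ := by
    rw [reflMap, inner_sub_left, real_inner_smul_left, real_inner_comm x (a k)]
    nlinarith [hx k]
  have h2 := hmax _ ⟨hrefl k u huN, h1⟩
  simp only [reflMap, inner_sub_right, inner_smul_right] at h2
  nlinarith [hρ k]

lemma reflMap_eq_reflection (a : V) : reflMap a = (ℝ ∙ a)ᗮ.reflection := by
  ext x
  rw [Submodule.reflection_orthogonal_apply, Submodule.reflection_singleton_apply, reflMap,
    real_inner_self_eq_norm_sq, real_inner_comm a x, mul_div_assoc]
  simp only [RCLike.ofReal_real_eq_id, id]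
  module

lemma reflMap_reflMap (a x : V) : reflMap a (reflMap a x) = x := by
  simp [reflMap_eq_reflection]

lemma inner_reflMap_reflMap (a x y : V) : ⟪reflMap a x, reflMap a y⟫ = ⟪x, y⟫ := by
  simp only [reflMap_eq_reflection, LinearIsometryEquiv.inner_map_map]

lemma reflMap_mem_facetNormals {Q : Set V} {v a u : V} (hQ : ∀ x ∈ Q, reflMap a x ∈ Q)
    (hv : ⟪v, a⟫ = 0) (hu : u ∈ facetNormals Q v) : reflMap a u ∈ facetNormals Q v := by
  have hfix : reflMap a v = v := by simp [reflMap, hv]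
  have hadj : ∀ y, ⟪reflMap a u, y⟫ = ⟪u, reflMap a y⟫ := fun y => by
    rw [← inner_reflMap_reflMap a u, reflMap_reflMap]
  refine ⟨?_, fun y hy => ?_, ?_⟩
  · rw [reflMap_eq_reflection, LinearIsometryEquiv.norm_map]
    exact hu.1
  · rw [hadj, hadj, hfix]
    exact hu.2.1 _ (hQ y hy)
  · have himg : levelSet Q (reflMap a u) v = reflMap a '' levelSet Q u v := by
      ext x
      constructor
      · rintro ⟨hx, h⟩
        rw [hadj, hadj, hfix] at h
        exact ⟨reflMap a x, ⟨hQ x hx, h⟩, reflMap_reflMap a x⟩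
      · rintro ⟨y, ⟨hy, h⟩, rfl⟩
        exact ⟨hQ y hy, by rw [inner_reflMap_reflMap, h, hadj, hfix]⟩
    have hspan := ((ℝ ∙ a)ᗮ.reflection.toLinearEquiv.toLinearMap.toAffineMap).map_vectorSpan
      (s := levelSet Q u v)
    have hcoe : ⇑((ℝ ∙ a)ᗮ.reflection.toLinearEquiv.toLinearMap.toAffineMap) = reflMap a := by
      rw [reflMap_eq_reflection]
      rfl
    rw [himg, ← hcoe, ← hspan, LinearMap.toAffineMap_linear, LinearEquiv.finrank_map_eq]
    exact hu.2.2

namespace RootSystemData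

variable {n : ℕ} (D : RootSystemData V n)

lemma inner_nonpos {i j : Fin n} (hij : i ≠ j) : ⟪D.α i, D.α j⟫ ≤ 0 := by
  by_contra! hpos
  have hαi : D.α i ≠ 0 := D.hα_indep.ne_zero i
  have hself : 0 < ⟪D.α i, D.α i⟫ := real_inner_self_pos.2 hαi
  have hmem : reflMap (D.α i) (D.α j) ∈ D.R := by
    rw [← D.hR_refl (D.α i) (D.hα_mem i)]
    exact ⟨_, D.hα_mem j, rfl⟩
  obtain ⟨c, hc, hsign⟩ := D.hα_sign _ hmem
  set s := 2 * ⟪D.α j, D.α i⟫ / ⟪D.α i, D.α i⟫ with hs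
  have hs0 : 0 < s := by
    rw [hs, real_inner_comm]
    positivity
  have hcomb : ∑ k, c k • D.α k =
      ∑ k, (Pi.single j 1 - s • Pi.single i 1 : Fin n → ℝ) k • D.α k := by
    rw [← hc]
    simp [reflMap, sub_smul, Finset.sum_sub_distrib, Pi.single_apply]
    rw [hs, real_inner_self_eq_norm_sq]
  have hceq := D.hα_indep.eq_coords_of_eq hcomb
  have hci : c i = -s := by simpa [Pi.single_apply, hij] using hceq i
  have hcj : c j = 1 := by simpa [Pi.single_apply, hij.symm] using hceq j
  rcases hsign with h | h
  · linarith [h i]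
  · linarith [h j]

lemma exists_linearIsometryEquiv_of_mem_WK {w : Function.End V} (hw : w ∈ WK D.α Set.univ) :
    ∃ g : V ≃ₗᵢ[ℝ] V, w = (g : V → V) ∧ ∀ β ∈ D.R, g β ∈ D.R := by
  induction hw using Submonoid.closure_induction with
  | mem w hw =>
    obtain ⟨k, -, rfl⟩ := hw
    refine ⟨(ℝ ∙ D.α k)ᗮ.reflection, reflMap_eq_reflection _, fun β hβ => ?_⟩
    rw [← reflMap_eq_reflection]
    have := D.hR_refl (D.α k) (D.hα_mem k)
    rw [← this]
    exact ⟨β, hβ, rfl⟩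
  | one => exact ⟨LinearIsometryEquiv.refl ℝ V, rfl, fun β hβ => hβ⟩
  | mul w w' _ _ h h' =>
    obtain ⟨g, rfl, hg⟩ := h
    obtain ⟨g', rfl, hg'⟩ := h'
    exact ⟨g'.trans g, rfl, fun β hβ => hg _ (hg' β hβ)⟩

lemma finite_WK : (WK D.α Set.univ : Set (Function.End V)).Finite := by
  refine Set.Finite.of_finite_image (f := fun w i => w (D.α i))
    ((Set.Finite.pi' fun _ : Fin n => D.hR_fin).subset ?_) ?_
  · rintro _ ⟨w, hw, rfl⟩ i
    obtain ⟨g, rfl, hg⟩ := D.exists_linearIsometryEquiv_of_mem_WK hw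
    exact hg _ (D.hα_mem i)
  · intro w hw w' hw' h
    obtain ⟨g, rfl, -⟩ := D.exists_linearIsometryEquiv_of_mem_WK hw
    obtain ⟨g', rfl, -⟩ := D.exists_linearIsometryEquiv_of_mem_WK hw'
    have : g.toLinearEquiv.toLinearMap = g'.toLinearEquiv.toLinearMap := by
      refine LinearMap.ext_on_range D.hα_span fun i => ?_
      exact congrFun h i
    funext x
    exact LinearMap.congr_fun this x

lemma exists_forall_inner_pos [FiniteDimensional ℝ V] : ∃ ρ : V, ∀ k, 0 < ⟪ρ, D.α k⟫ := by
  obtain ⟨d, hd⟩ := exists_dual_of_linearIndependent D.hα_indep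
  refine ⟨∑ j, d j, fun k => ?_⟩
  rw [real_inner_comm, inner_sum]
  simp [hd]

end RootSystemData

namespace PermSetup

variable {n : ℕ} (S : PermSetup V n)

lemma finite_orbits : (⋃ w ∈ WK S.α Set.univ, Set.image w S.Λ).Finite :=
  S.finite_WK.biUnion fun _ _ => S.hΛ_fin.image _

lemma reflMap_mem_WK (k : Fin n) : (reflMap (S.α k) : Function.End V) ∈ WK S.α Set.univ :=
  Submonoid.subset_closure ⟨k, Set.mem_univ k, rfl⟩

lemma reflMap_mem_P (k : Fin n) {x : V} (hx : x ∈ S.P) : reflMap (S.α k) x ∈ S.P := by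
  have hconv : Convex ℝ (reflMap (S.α k) ⁻¹' S.P) := by
    rw [reflMap_eq_reflection]
    exact (convex_convexHull ℝ _).linear_preimage
      (ℝ ∙ S.α k)ᗮ.reflection.toLinearEquiv.toLinearMap
  refine convexHull_min ?_ hconv hx
  intro y hy
  simp only [Set.mem_iUnion] at hy
  obtain ⟨w, hw, l, hl, rfl⟩ := hy
  refine subset_convexHull ℝ _ ?_
  simp only [Set.mem_iUnion]
  exact ⟨_, mul_mem (S.reflMap_mem_WK k) hw, l, hl, rfl⟩

lemma reflMap_mem_interior_P (k : Fin n) {x : V} (hx : x ∈ interior S.P) :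
    reflMap (S.α k) x ∈ interior S.P := by
  have hcont : Continuous (reflMap (S.α k)) := by
    rw [reflMap_eq_reflection]
    exact (ℝ ∙ S.α k)ᗮ.reflection.continuous
  have hsub : reflMap (S.α k) ⁻¹' interior S.P ⊆ interior S.P := by
    refine interior_maximal (fun y hy => ?_) (isOpen_interior.preimage hcont)
    rw [← reflMap_reflMap (S.α k) y]
    exact S.reflMap_mem_P k (interior_subset hy)
  refine hsub ?_
  rwa [Set.mem_preimage, reflMap_reflMap]

lemma apply_mem_interior_P {w : Function.End V} (hw : w ∈ WK S.α Set.univ) :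
    ∀ x ∈ interior S.P, w x ∈ interior S.P := by
  induction hw using Submonoid.closure_induction with
  | mem w hw =>
    obtain ⟨k, -, rfl⟩ := hw
    exact fun x hx => S.reflMap_mem_interior_P k hx
  | one => exact fun x hx => hx
  | mul w w' _ _ h h' => exact fun x hx => h _ (h' x hx)

variable [FiniteDimensional ℝ V]

lemma exists_mem_interior_P_forall_inner_pos (hfull : (interior S.P).Nonempty) :
    ∃ q ∈ interior S.P, ∀ k, 0 < ⟪q, S.α k⟫ := by
  obtain ⟨ρ, hρ⟩ := S.exists_forall_inner_pos
  obtain ⟨p, hp⟩ := hfull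
  obtain ⟨w, hw, hmax⟩ := Set.exists_max_image _ (fun w : Function.End V => ⟪ρ, w p⟫) S.finite_WK
    ⟨1, one_mem (WK S.α Set.univ)⟩
  have hdom : ∀ k, 0 ≤ ⟪w p, S.α k⟫ := by
    intro k
    have h : ⟪ρ, reflMap (S.α k) (w p)⟫ ≤ ⟪ρ, w p⟫ :=
      hmax _ (mul_mem (S.reflMap_mem_WK k) hw)
    by_contra! hneg
    have hself : 0 < ⟪S.α k, S.α k⟫ := real_inner_self_pos.2 (S.hα_indep.ne_zero k)
    have hs : 2 * ⟪w p, S.α k⟫ / ⟪S.α k, S.α k⟫ < 0 :=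
      div_neg_of_neg_of_pos (by linarith) hself
    simp only [reflMap, inner_sub_right, inner_smul_right] at h
    nlinarith [hρ k]
  obtain ⟨t, ht, -, hm, -⟩ := exists_pos_add_smul_mem
    (isOpen_interior.mem_nhds (S.apply_mem_interior_P hw p hp)) ρ one_pos
  refine ⟨_, hm, fun k => ?_⟩
  rw [inner_add_left, real_inner_smul_left]
  have := mul_pos ht (hρ k)
  linarith [hdom k]

lemma interior_inter_cham_nonempty (hfull : (interior S.P).Nonempty) (K : Set (Fin n)) :
    (interior (S.P ∩ cham S.α K)).Nonempty := by
  obtain ⟨q, hq, hpos⟩ := S.exists_mem_interior_P_forall_inner_pos hfull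
  refine ⟨q, mem_interior_iff_mem_nhds.2 (Filter.inter_mem (mem_interior_iff_mem_nhds.1 hq) ?_)⟩
  have : ∀ᶠ x in 𝓝 q, ∀ k, 0 < ⟪x, S.α k⟫ := by
    refine Filter.eventually_all.2 fun k => ?_
    have hc : Continuous fun x : V => ⟪x, S.α k⟫ := by fun_prop
    exact (hc.tendsto q).eventually (lt_mem_nhds (hpos k))
  filter_upwards [this] with x hx k _ using (hx k).le

lemma eventually_mem_inter_cham_iff (hfull : (interior S.P).Nonempty) {K : Set (Fin n)} {v : V}
    (hv : v ∈ S.P ∩ cham S.α K) :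
    ∀ᶠ x in 𝓝 v, x ∈ S.P ∩ cham S.α K ↔
      (∀ u ∈ facetNormals S.P v, ⟪u, x - v⟫ ≤ 0) ∧
        ∀ k : {k // k ∈ K ∧ ⟪v, S.α k⟫ = 0}, 0 ≤ ⟪x - v, S.α k⟫ := by
  have hfar : ∀ᶠ x in 𝓝 v, ∀ k, 0 < ⟪v, S.α k⟫ → 0 < ⟪x, S.α k⟫ := by
    refine Filter.eventually_all.2 fun k => ?_
    by_cases h : 0 < ⟪v, S.α k⟫
    · have hc : Continuous fun x : V => ⟪x, S.α k⟫ := by fun_prop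
      filter_upwards [(hc.tendsto v).eventually (lt_mem_nhds h)] with x hx _ using hx
    · simp [h]
  filter_upwards [eventually_mem_convexHull_iff S.finite_orbits hfull hv.1, hfar] with x hxP hx
  refine and_congr hxP ⟨fun h k => ?_, fun h k hk => ?_⟩
  · rw [inner_sub_left, k.2.2, sub_zero]
    exact h k k.2.1
  · rcases (hv.2 k hk).eq_or_lt' with h0 | h0
    · have : 0 ≤ ⟪x - v, S.α k⟫ := h ⟨k, hk, h0⟩
      rwa [inner_sub_left, h0, sub_zero] at this
    · exact (hx k h0).le

lemma isSimple_inter_cham (hfull : (interior S.P).Nonempty) (K : Set (Fin n))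
    (hsimple : IsSimple S.P) : IsSimple (S.P ∩ cham S.α K) := by
  classical
  intro v hv
  have : Nontrivial V := Module.finrank_pos_iff.1 (S.hdim.symm ▸ S.hn)
  obtain ⟨ρ, hρ⟩ := S.exists_forall_inner_pos
  set N := facetNormals S.P v with hN
  set J := {k // k ∈ K ∧ ⟪v, S.α k⟫ = 0} with hJ
  have hindep : LinearIndepOn ℝ id N := hsimple.linearIndepOn_facetNormals S.finite_orbits hfull hv.1.1
  have hrefl : ∀ k : J, ∀ u ∈ N, reflMap (S.α k) u ∈ N := fun k u hu =>
    reflMap_mem_facetNormals (fun x hx => S.reflMap_mem_P k hx) k.2.2 hu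
  set D : Set V := {u ∈ N | ∀ k : J, 0 ≤ ⟪u, S.α k⟫} with hD
  have hNfin : N.Finite := hindep.linearIndependent.setFinite
  have hDfin : D.Finite := hNfin.subset fun u hu => hu.1
  have := hDfin.fintype
  have hcard : D.ncard + Fintype.card J ≤ finrank ℝ V :=
    ncard_dominant_add_card_le hindep (a := fun k : J => S.α k)
      (S.hα_indep.comp _ Subtype.val_injective)
      (fun i j hij => S.inner_nonpos fun h => hij (Subtype.ext h)) hrefl
  let b : D ⊕ J → V := Sum.elim (fun u => (u : V)) fun k => -S.α k
  have hloc : ∀ᶠ x in 𝓝 v, x ∈ S.P ∩ cham S.α K ↔ ∀ i, ⟪b i, x - v⟫ ≤ 0 := by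
    filter_upwards [S.eventually_mem_inter_cham_iff hfull hv.1] with x hx
    rw [hx, Sum.forall]
    have hneg : (∀ k : J, ⟪b (Sum.inr k), x - v⟫ ≤ 0) ↔ ∀ k : J, 0 ≤ ⟪x - v, S.α k⟫ :=
      forall_congr' fun k => by
        rw [real_inner_comm (S.α k) (x - v)]
        simp [b]
    rw [hneg]
    refine and_congr_left fun hk => ⟨fun h u => h u u.2.1, fun h => ?_⟩
    exact inner_nonpos_of_forall_dominant hNfin hrefl (fun k => hρ k) hk
      fun u hu hdom => h ⟨u, hu, hdom⟩
  have hspan : Submodule.span ℝ (Set.range b) = ⊤ :=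
    span_eq_top_of_mem_extremePoints hv
      (hloc.mono fun x hx h => hx.2 fun i => h _ ⟨i, rfl⟩)
  have hb : LinearIndependent ℝ b := by
    refine linearIndependent_of_top_le_span_of_card_le_finrank hspan.ge ?_
    rwa [Fintype.card_sum, ← Nat.card_eq_fintype_card (α := D), Nat.card_coe_set_eq]
  refine ncard_facets_of_eventually_mem_iff ?_ hv.1 hb hspan hloc
  refine (convex_convexHull ℝ _).inter ?_
  intro x hx y hy s t hs ht _ k hk
  rw [inner_add_left, real_inner_smul_left, real_inner_smul_left]
  exact add_nonneg (mul_nonneg hs (hx k hk)) (mul_nonneg ht (hy k hk))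

end PermSetup

/-- Lemma 6.3: for `n = 3` and a (possibly degenerate) `W`-symmetric polytope `P`, if
`P` is simple then the full-dimensional polytope `P ∩ C_K` is simple. -/
theorem statement_18 {V : Type*} [NormedAddCommGroup V] [InnerProductSpace ℝ V]
    [FiniteDimensional ℝ V] (S : PermSetup V 3)
    (hfull : (interior S.P).Nonempty) (K : Set (Fin 3))
    (hsimple : IsSimple S.P) :
    (interior (S.P ∩ cham S.α K)).Nonempty ∧ IsSimple (S.P ∩ cham S.α K) := by
  exact ⟨S.interior_inter_cham_nonempty hfull K, S.isSimple_inter_cham hfull K hsimple⟩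
end
end
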